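/- Consider the SDE dX_t = b(t, X_t) dt + dB_t, X_0 = 0, on [0,3], where b(t,x) = 1_{x>0}((1−x)/(1−t) + 1/x) + 1_{x<0}((−1−x)/(1−t) + 1/x) for 0 ≤ t < 1, b(t,x) = 0 for 1 ≤ t < 2, and b(t,x) = −1_{x≠0, |x|≤1}/(2x) + 1_{x>1}/(x−1) + 1_{x<−1}/(x+1) for 2 ≤ t ≤ 3. Then there exists no weak solution to this SDE. -/

import Mathlib

open MeasureTheory ProbabilityTheory Set
open scoped Classical

noncomputable section

/-- `B` is a Brownian motion with respect to the filtration `F` under `P`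
(properties required for times `t ≥ 0`). -/
def IsBrownian {Ω : Type*} [MeasurableSpace Ω] (F : ℝ → MeasurableSpace Ω)
    (P : Measure Ω) (B : ℝ → Ω → ℝ) : Prop :=
  (∀ ω, Continuous fun t => B t ω) ∧
  (∀ᵐ ω ∂P, B 0 ω = 0) ∧
  (∀ t, 0 ≤ t → Measurable[F t] (B t)) ∧
  (∀ s t, 0 ≤ s → s ≤ t →
    Indep (MeasurableSpace.comap (fun ω => B t ω - B s ω)
      (inferInstance : MeasurableSpace ℝ)) (F s) P) ∧
  (∀ s t, 0 ≤ s → s ≤ t →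
    Measure.map (fun ω => B t ω - B s ω) P = gaussianReal 0 (Real.toNNReal (t - s)))

/-- `(X, B)` is a weak solution on `[0, T]` of `dX = b(t, X) dt + dB` with
initial condition `x₀`, on a filtered space `(Ω, F, P)`. -/
def IsWeakSolutionOn {Ω : Type*} [m : MeasurableSpace Ω] (F : ℝ → MeasurableSpace Ω)
    (P : Measure Ω) (b : ℝ → ℝ → ℝ) (X B : ℝ → Ω → ℝ) (x₀ : Ω → ℝ) (T : ℝ) : Prop :=
  (∀ t, 0 ≤ t → F t ≤ m) ∧
  (∀ s t, 0 ≤ s → s ≤ t → F s ≤ F t) ∧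
  IsBrownian F P B ∧
  (∀ ω, Continuous fun t => X t ω) ∧
  (∀ t, 0 ≤ t → Measurable[F t] (X t)) ∧
  (∀ᵐ ω ∂P, X 0 ω = x₀ ω) ∧
  (∀ᵐ ω ∂P, ∀ t ∈ Set.Icc (0 : ℝ) T,
    IntegrableOn (fun s => b s (X s ω)) (Set.Icc 0 t) ∧
    X t ω = x₀ ω + (∫ s in (0:ℝ)..t, b s (X s ω)) + B t ω)

/-- The drift of the counterexample SDE on `[0, 3]`. -/
def bCE (t x : ℝ) : ℝ :=
  if t < 1 then
    (if 0 < x then (1 - x) / (1 - t) + 1 / x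
     else if x < 0 then (-1 - x) / (1 - t) + 1 / x else 0)
  else if t < 2 then 0
  else
    (if x ≠ 0 ∧ |x| ≤ 1 then -1 / (2 * x) else 0) +
    (if 1 < x then 1 / (x - 1) else 0) +
    (if x < -1 then 1 / (x + 1) else 0)

/-- `f` is a bounded `C²` function with derivatives `f'` and `f''` bounded by `C`, the second
derivative being uniformly continuous. -/
structure IsTestFunction (f f' f'' : ℝ → ℝ) (C : ℝ) : Prop where
  hasDerivAt : ∀ x, HasDerivAt f (f' x) x
  hasDerivAt' : ∀ x, HasDerivAt f' (f'' x) x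
  bound : ∀ x, |f x| ≤ C
  bound' : ∀ x, |f' x| ≤ C
  bound'' : ∀ x, |f'' x| ≤ C
  uniformContinuous : UniformContinuous f''

theorem exists_abs_le_of_eq_zero_off_Icc {g : ℝ → ℝ} (hg : Continuous g)
    (h0 : ∀ x, 1 ≤ |x| → g x = 0) : ∃ C, ∀ x, |g x| ≤ C := by
  obtain ⟨C, hC⟩ := isCompact_Icc (a := (-1 : ℝ)) (b := 1) |>.exists_bound_of_continuousOn
    hg.continuousOn
  refine ⟨C, fun x => ?_⟩
  by_cases hx : |x| ≤ 1
  · exact hC x (abs_le.mp hx)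
  · rw [h0 x (le_of_not_ge hx), abs_zero]
    exact (norm_nonneg _).trans (hC 0 (by simp))

theorem exists_isTestFunction {f f' f'' : ℝ → ℝ} (h1 : ∀ x, HasDerivAt f (f' x) x)
    (h2 : ∀ x, HasDerivAt f' (f'' x) x) (h3 : Continuous f'')
    (z : ∀ x, 1 ≤ |x| → f x = 0) (z' : ∀ x, 1 ≤ |x| → f' x = 0)
    (z'' : ∀ x, 1 ≤ |x| → f'' x = 0) : ∃ C, IsTestFunction f f' f'' C := by
  obtain ⟨C, hC⟩ := exists_abs_le_of_eq_zero_off_Icc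
    (continuous_iff_continuousAt.2 fun x => (h1 x).continuousAt) z
  obtain ⟨C', hC'⟩ := exists_abs_le_of_eq_zero_off_Icc
    (continuous_iff_continuousAt.2 fun x => (h2 x).continuousAt) z'
  obtain ⟨C'', hC''⟩ := exists_abs_le_of_eq_zero_off_Icc h3 z''
  refine ⟨max C (max C' C''), h1, h2, fun x => (hC x).trans (by simp),
    fun x => (hC' x).trans (by simp), fun x => (hC'' x).trans (by simp), ?_⟩
  refine HasCompactSupport.uniformContinuous_of_continuous ?_ h3
  refine HasCompactSupport.intro (isCompact_Icc (a := (-1 : ℝ)) (b := 1)) fun x hx => z'' x ?_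
  by_contra h
  exact hx (abs_le.mp (le_of_not_ge h))

namespace IsTestFunction

variable {f f' f'' : ℝ → ℝ} {C : ℝ}

theorem nonneg (hf : IsTestFunction f f' f'' C) : 0 ≤ C := (abs_nonneg _).trans (hf.bound 0)

theorem continuous (hf : IsTestFunction f f' f'' C) : Continuous f :=
  continuous_iff_continuousAt.2 fun x => (hf.hasDerivAt x).continuousAt

theorem continuous' (hf : IsTestFunction f f' f'' C) : Continuous f' :=
  continuous_iff_continuousAt.2 fun x => (hf.hasDerivAt' x).continuousAt

theorem abs_sub_le (hf : IsTestFunction f f' f'' C) (x y : ℝ) : |f y - f x| ≤ C * |y - x| :=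
  convex_univ.norm_image_sub_le_of_norm_hasDerivWithin_le
    (fun x _ => (hf.hasDerivAt x).hasDerivWithinAt) (fun x _ => hf.bound' x)
    (mem_univ x) (mem_univ y)

theorem abs_sub_le' (hf : IsTestFunction f f' f'' C) (x y : ℝ) : |f' y - f' x| ≤ C * |y - x| :=
  convex_univ.norm_image_sub_le_of_norm_hasDerivWithin_le
    (fun x _ => (hf.hasDerivAt' x).hasDerivWithinAt) (fun x _ => hf.bound'' x)
    (mem_univ x) (mem_univ y)

theorem exists_mem_uIcc (hf : IsTestFunction f f' f'' C) (x y : ℝ) :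
    ∃ c ∈ uIcc x y, f y - f x = f' c * (y - x) := by
  rcases lt_trichotomy x y with h | h | h
  · obtain ⟨c, hc, e⟩ := exists_hasDerivAt_eq_slope f f' h hf.continuous.continuousOn
      fun x _ => hf.hasDerivAt x
    refine ⟨c, ?_, ?_⟩
    · rw [uIcc_of_le h.le]; exact Ioo_subset_Icc_self hc
    · rw [e]; field_simp [sub_ne_zero.2 h.ne']
  · exact ⟨x, left_mem_uIcc, by simp [h]⟩
  · obtain ⟨c, hc, e⟩ := exists_hasDerivAt_eq_slope f f' h hf.continuous.continuousOn
      fun x _ => hf.hasDerivAt x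
    refine ⟨c, ?_, ?_⟩
    · rw [uIcc_of_ge h.le]; exact Ioo_subset_Icc_self hc
    · rw [e]
      have := sub_ne_zero.2 h.ne'
      field_simp
      ring

/-- Second-order Taylor expansion with uniform remainder. -/
theorem taylor (hf : IsTestFunction f f' f'' C) {η : ℝ} (hη : 0 < η) :
    ∃ K, 0 ≤ K ∧ ∀ x y,
      |f (x + y) - f x - f' x * y - f'' x / 2 * y ^ 2| ≤ η * y ^ 2 + K * |y| ^ 3 := by
  obtain ⟨δ, hδ, h⟩ := Metric.uniformContinuous_iff.1 hf.uniformContinuous η hη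
  have hC := hf.nonneg
  refine ⟨2 * C / δ, by positivity, fun x y => ?_⟩
  set ω := η + 2 * C / δ * |y| with hω
  have hω0 : 0 ≤ ω := by positivity
  have key : ∀ z ∈ uIcc x (x + y), |f'' z - f'' x| ≤ ω := by
    intro z hz
    have hzx : |z - x| ≤ |y| := by
      have := abs_sub_left_of_mem_uIcc hz
      simpa using this
    by_cases hd : |z - x| < δ
    · have := h (a := z) (b := x) (by rwa [Real.dist_eq])
      rw [Real.dist_eq] at this
      have : 0 ≤ 2 * C / δ * |y| := by positivity
      linarith
    · have h1 : |f'' z - f'' x| ≤ 2 * C := by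
        have := abs_sub (f'' z) (f'' x)
        linarith [hf.bound'' z, hf.bound'' x]
      have h2 : 2 * C ≤ 2 * C / δ * |y| := by
        rw [div_mul_eq_mul_div, le_div_iff₀ hδ]
        have : δ ≤ |y| := (not_lt.1 hd).trans hzx
        gcongr
      linarith
  have h1 : ∀ z ∈ uIcc x (x + y), |f' z - f' x - f'' x * (z - x)| ≤ ω * |y| := by
    intro z hz
    have hzx : |z - x| ≤ |y| := by
      have := abs_sub_left_of_mem_uIcc hz
      simpa using this
    have := (convex_uIcc x (x + y)).norm_image_sub_le_of_norm_hasDerivWithin_le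
      (f := fun z => f' z - f'' x * z) (f' := fun z => f'' z - f'' x) (C := ω)
      (fun w _ => (((hf.hasDerivAt' w).fun_sub ((hasDerivAt_id' w).const_mul (f'' x))).congr_deriv
        (by ring)).hasDerivWithinAt)
      (fun w hw => key w hw) left_mem_uIcc hz
    simp only [Real.norm_eq_abs] at this
    calc _ = |f' z - f'' x * z - (f' x - f'' x * x)| := by ring_nf
      _ ≤ ω * |z - x| := this
      _ ≤ _ := by gcongr
  have h2 := (convex_uIcc x (x + y)).norm_image_sub_le_of_norm_hasDerivWithin_le
      (f := fun z => f z - f' x * z - f'' x / 2 * (z - x) ^ 2)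
      (f' := fun z => f' z - f' x - f'' x * (z - x)) (C := ω * |y|)
      (fun w _ => ((((hf.hasDerivAt w).fun_sub ((hasDerivAt_id' w).const_mul (f' x))).fun_sub
          ((((hasDerivAt_id' w).sub_const x).fun_pow 2).const_mul (f'' x / 2))).congr_deriv
          (by ring)).hasDerivWithinAt)
      h1 left_mem_uIcc right_mem_uIcc
  simp only [Real.norm_eq_abs] at h2
  calc _ = |f (x + y) - f' x * (x + y) - f'' x / 2 * (x + y - x) ^ 2
        - (f x - f' x * x - f'' x / 2 * (x - x) ^ 2)| := by ring_nf
    _ ≤ ω * |y| * |x + y - x| := h2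
    _ = ω * |y| ^ 2 := by rw [add_sub_cancel_left]; ring
    _ = _ := by rw [hω, ← sq_abs y]; ring

end IsTestFunction

theorem integrable_pow_gaussianReal (v : NNReal) (n : ℕ) :
    Integrable (fun z => z ^ n) (gaussianReal 0 v) := by
  have h := (memLp_id_gaussianReal (μ := 0) (v := v) n).integrable_norm_pow'
  refine h.mono' (by fun_prop) (ae_of_all _ fun z => ?_)
  simp

theorem integral_sq_gaussianReal {h : ℝ} (hh : 0 ≤ h) :
    ∫ z, z ^ 2 ∂(gaussianReal 0 h.toNNReal) = h := by
  have := variance_fun_id_gaussianReal (μ := 0) (v := h.toNNReal)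
  rw [variance_eq_integral (by fun_prop)] at this
  simpa [integral_id_gaussianReal, hh] using this

theorem integrable_abs_cube_gaussianReal (v : NNReal) :
    Integrable (fun z => |z| ^ 3) (gaussianReal 0 v) := by
  simpa [abs_pow] using (integrable_pow_gaussianReal v 3).abs

theorem integral_abs_cube_gaussianReal {h : ℝ} (hh : 0 ≤ h) :
    ∫ z, |z| ^ 3 ∂(gaussianReal 0 h.toNNReal)
      = (∫ z, |z| ^ 3 ∂(gaussianReal 0 1)) * (h * √h) := by
  have e : gaussianReal 0 h.toNNReal = (gaussianReal 0 1).map (fun x => √h * x) := by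
    rw [gaussianReal_map_const_mul]
    congr 1
    · simp
    · ext; simp [Real.sq_sqrt hh, hh]
  rw [e, integral_map (by fun_prop) (by fun_prop), ← integral_mul_const]
  congr 1
  ext z
  rw [abs_mul, mul_pow, abs_of_nonneg (Real.sqrt_nonneg h)]
  have : √h ^ 3 = h * √h := by rw [pow_succ, Real.sq_sqrt hh]
  rw [this]; ring

/-- The expected increment of `f` over a Brownian step of length `h` started at `x`. -/
def gaussIncr (f : ℝ → ℝ) (h x : ℝ) : ℝ :=
  ∫ z, (f (x + z) - f x) ∂(gaussianReal 0 h.toNNReal)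

/-- The increment of `f` over a step `y`, centred by the expected increment over a Brownian
step of length `h`. -/
def centredIncr (f : ℝ → ℝ) (h x y : ℝ) : ℝ := f (x + y) - f x - gaussIncr f h x

namespace IsTestFunction

variable {f f' f'' : ℝ → ℝ} {C : ℝ}

theorem abs_incr_le (hf : IsTestFunction f f' f'' C) (x z : ℝ) : |f (x + z) - f x| ≤ 2 * C := by
  have := abs_sub (f (x + z)) (f x)
  linarith [hf.bound (x + z), hf.bound x]

theorem integrable_incr (hf : IsTestFunction f f' f'' C) (x : ℝ) (μ : Measure ℝ)
    [IsFiniteMeasure μ] : Integrable (fun z => f (x + z) - f x) μ := by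
  have := hf.continuous
  exact .of_bound (by fun_prop) (2 * C) (ae_of_all _ fun z => hf.abs_incr_le x z)

theorem gaussIncr_expansion (hf : IsTestFunction f f' f'' C) {η : ℝ} (hη : 0 < η) :
    ∃ K, 0 ≤ K ∧ ∀ h, 0 ≤ h → ∀ x,
      |gaussIncr f h x - h * (f'' x / 2)| ≤ η * h + K * (h * √h) := by
  obtain ⟨K, hK, hT⟩ := hf.taylor hη
  refine ⟨K * ∫ z, |z| ^ 3 ∂(gaussianReal 0 1), by positivity, fun h hh x => ?_⟩
  have i1 := integrable_pow_gaussianReal h.toNNReal 1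
  have i2 := integrable_pow_gaussianReal h.toNNReal 2
  have i3 := integrable_abs_cube_gaussianReal h.toNNReal
  simp only [pow_one] at i1
  have e : gaussIncr f h x - h * (f'' x / 2)
      = ∫ z, (f (x + z) - f x - f' x * z - f'' x / 2 * z ^ 2) ∂(gaussianReal 0 h.toNNReal) := by
    have i0 := hf.integrable_incr x (gaussianReal 0 h.toNNReal)
    have j : Integrable (fun z => f (x + z) - f x - f' x * z) (gaussianReal 0 h.toNNReal) :=
      i0.sub (i1.const_mul _)
    rw [integral_sub j (i2.const_mul _), integral_sub i0 (i1.const_mul _), integral_const_mul,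
      integral_const_mul, integral_id_gaussianReal, integral_sq_gaussianReal hh, gaussIncr]
    ring
  rw [e, ← Real.norm_eq_abs]
  calc _ ≤ ∫ z, (η * z ^ 2 + K * |z| ^ 3) ∂(gaussianReal 0 h.toNNReal) :=
        norm_integral_le_of_norm_le ((i2.const_mul _).add (i3.const_mul _))
          (ae_of_all _ fun z => hT x z)
    _ = _ := by
      rw [integral_add (i2.const_mul _) (i3.const_mul _), integral_const_mul, integral_const_mul,
        integral_sq_gaussianReal hh, integral_abs_cube_gaussianReal hh, mul_assoc]

theorem abs_gaussIncr_le (hf : IsTestFunction f f' f'' C) (h x : ℝ) :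
    |gaussIncr f h x| ≤ 2 * C := by
  simpa [gaussIncr] using norm_integral_le_of_norm_le_const (μ := gaussianReal 0 h.toNNReal)
    (f := fun z => f (x + z) - f x) (ae_of_all _ fun z => hf.abs_incr_le x z)

theorem abs_centredIncr_le (hf : IsTestFunction f f' f'' C) (h x y : ℝ) :
    |centredIncr f h x y| ≤ 4 * C := by
  have := abs_sub (f (x + y) - f x) (gaussIncr f h x)
  rw [centredIncr]
  linarith [hf.abs_incr_le x y, hf.abs_gaussIncr_le h x]

theorem measurable_centredIncr (hf : IsTestFunction f f' f'' C) (h : ℝ) :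
    Measurable fun p : ℝ × ℝ => centredIncr f h p.1 p.2 := by
  have hc := hf.continuous
  have : StronglyMeasurable (gaussIncr f h) := by
    refine StronglyMeasurable.integral_prod_right (f := fun x z => f (x + z) - f x) ?_
    exact Continuous.stronglyMeasurable (f := fun p : ℝ × ℝ => f (p.1 + p.2) - f p.1) (by fun_prop)
  have h1 := this.measurable
  unfold centredIncr
  fun_prop

theorem integral_centredIncr (hf : IsTestFunction f f' f'' C) (h x : ℝ) :
    ∫ y, centredIncr f h x y ∂(gaussianReal 0 h.toNNReal) = 0 := by
  unfold centredIncr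
  rw [integral_sub (hf.integrable_incr x _) (integrable_const _)]
  simp [gaussIncr]

theorem integral_centredIncr_sq_le (hf : IsTestFunction f f' f'' C) {h : ℝ} (hh : 0 ≤ h) (x : ℝ) :
    ∫ y, centredIncr f h x y ^ 2 ∂(gaussianReal 0 h.toNNReal) ≤ C ^ 2 * h := by
  have hc := hf.continuous
  have hC := hf.nonneg
  have i0 := hf.integrable_incr x (gaussianReal 0 h.toNNReal)
  have i1 : Integrable (fun z => (f (x + z) - f x) ^ 2) (gaussianReal 0 h.toNNReal) := by
    refine .of_bound (by fun_prop) ((2 * C) ^ 2) (ae_of_all _ fun z => ?_)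
    rw [norm_pow]
    exact pow_le_pow_left₀ (norm_nonneg _) (hf.abs_incr_le x z) 2
  have i2 := integrable_pow_gaussianReal h.toNNReal 2
  have e : ∫ y, centredIncr f h x y ^ 2 ∂(gaussianReal 0 h.toNNReal)
      = (∫ z, (f (x + z) - f x) ^ 2 ∂(gaussianReal 0 h.toNNReal)) - gaussIncr f h x ^ 2 := by
    have : ∀ y, centredIncr f h x y ^ 2 = (f (x + y) - f x) ^ 2
        - 2 * gaussIncr f h x * (f (x + y) - f x) + gaussIncr f h x ^ 2 := by
      intro y; rw [centredIncr]; ring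
    simp_rw [this]
    have j : Integrable (fun y => (f (x + y) - f x) ^ 2
        - 2 * gaussIncr f h x * (f (x + y) - f x)) (gaussianReal 0 h.toNNReal) :=
      i1.sub (i0.const_mul _)
    rw [integral_add j (integrable_const _),
      integral_sub i1 (i0.const_mul _), integral_const_mul, ← gaussIncr]
    simp
    ring
  rw [e]
  calc _ ≤ ∫ z, (f (x + z) - f x) ^ 2 ∂(gaussianReal 0 h.toNNReal) := by
        linarith [sq_nonneg (gaussIncr f h x)]
    _ ≤ ∫ z, C ^ 2 * z ^ 2 ∂(gaussianReal 0 h.toNNReal) := by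
        refine integral_mono i1 (i2.const_mul _) fun z => ?_
        have := hf.abs_sub_le x (x + z)
        rw [add_sub_cancel_left] at this
        calc (f (x + z) - f x) ^ 2 = |f (x + z) - f x| ^ 2 := (sq_abs _).symm
          _ ≤ (C * |z|) ^ 2 := by gcongr
          _ = _ := by rw [mul_pow, sq_abs]
    _ = _ := by rw [integral_const_mul, integral_sq_gaussianReal hh]

end IsTestFunction

namespace IsTestFunction

variable {f f' f'' : ℝ → ℝ} {C : ℝ}

theorem intervalIntegrable_comp_mul (hf : IsTestFunction f f' f'' C) {x β : ℝ → ℝ} {s s' : ℝ}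
    (hx : Continuous x) (hβ : IntervalIntegrable β volume s s') :
    IntervalIntegrable (fun r => f' (x r) * β r) volume s s' :=
  hβ.continuousOn_mul (hf.continuous'.comp hx).continuousOn

theorem intervalIntegrable_comp (hf : IsTestFunction f f' f'' C) {x : ℝ → ℝ} (s s' : ℝ)
    (hx : Continuous x) :
    IntervalIntegrable (fun r => f'' (x r) / 2) volume s s' := by
  have := hf.uniformContinuous.continuous
  exact Continuous.intervalIntegrable (by fun_prop) _ _

/-- One-step comparison between the centred increment and the Itô remainder. -/
theorem step_error (hf : IsTestFunction f f' f'' C) {x w β : ℝ → ℝ} {s s' ε η K : ℝ}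
    (hss : s ≤ s') (hx : Continuous x) (hβ : IntervalIntegrable β volume s s')
    (heq : x s' = x s + (∫ r in s..s', β r) + (w s' - w s))
    (hxε : ∀ r ∈ Icc s s', ∀ r' ∈ Icc s s', |x r - x r'| ≤ ε) (hwε : |w s' - w s| ≤ ε)
    (hη : ∀ y z, |y - z| ≤ ε → |f'' y - f'' z| ≤ η)
    (hK : ∀ h, 0 ≤ h → ∀ x, |gaussIncr f h x - h * (f'' x / 2)| ≤ η * h + K * (h * √h)) :
    |centredIncr f (s' - s) (x s) (w s' - w s)
      - (f (x s') - f (x s) - ∫ r in s..s', (f' (x r) * β r + f'' (x r) / 2))|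
      ≤ 3 * C * ε * (∫ r in s..s', |β r|) + (2 * η * (s' - s) + K * ((s' - s) * √(s' - s))) := by
  have hC := hf.nonneg
  have hs : s ∈ Icc s s' := left_mem_Icc.2 hss
  have hs' : s' ∈ Icc s s' := right_mem_Icc.2 hss
  have hε : 0 ≤ ε := (abs_nonneg _).trans hwε
  have hη0 : 0 ≤ η := (abs_nonneg _).trans (hη 0 0 (by simpa using hε))
  have j1 := hf.intervalIntegrable_comp_mul hx hβ
  have j2 := hf.intervalIntegrable_comp s s' hx
  obtain ⟨c, hc, e⟩ := hf.exists_mem_uIcc (x s + (w s' - w s)) (x s')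
  have hA : x s' - (x s + (w s' - w s)) = ∫ r in s..s', β r := by linarith
  have hAε : |x s' - (x s + (w s' - w s))| ≤ 2 * ε := by
    have h1 := abs_sub (x s' - x s) (w s' - w s)
    have h2 := hxε s' hs' s hs
    rw [← sub_sub]
    linarith
  have hcε : ∀ r ∈ Icc s s', |c - x r| ≤ 3 * ε := by
    intro r hr
    have h1 := abs_sub_right_of_mem_uIcc hc
    have h2 := hxε s' hs' r hr
    have h3 := _root_.abs_sub_le c (x s') (x r)
    rw [abs_sub_comm] at h1
    linarith
  rw [hA] at e
  have I1 : |f' c * (∫ r in s..s', β r) - ∫ r in s..s', f' (x r) * β r|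
      ≤ 3 * C * ε * ∫ r in s..s', |β r| := by
    rw [← intervalIntegral.integral_const_mul, ← intervalIntegral.integral_sub (hβ.const_mul _) j1,
      ← intervalIntegral.integral_const_mul, ← Real.norm_eq_abs]
    refine intervalIntegral.norm_integral_le_of_norm_le hss (ae_of_all _ fun r hr => ?_)
      (hβ.abs.const_mul _)
    rw [← sub_mul, norm_mul, Real.norm_eq_abs, Real.norm_eq_abs]
    have h1 := hf.abs_sub_le' (x r) c
    have h2 := hcε r (Ioc_subset_Icc_self hr)
    have : C * |c - x r| ≤ C * (3 * ε) := by gcongr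
    gcongr
    linarith
  have I2 : |(s' - s) * (f'' (x s) / 2) - ∫ r in s..s', f'' (x r) / 2| ≤ η * (s' - s) := by
    have : (s' - s) * (f'' (x s) / 2) = ∫ r in s..s', f'' (x s) / 2 := by
      rw [intervalIntegral.integral_const, smul_eq_mul]
    rw [this, ← intervalIntegral.integral_sub (by simp) j2]
    have := intervalIntegral.norm_integral_le_of_norm_le_const (a := s) (b := s') (C := η)
      (f := fun r => f'' (x s) / 2 - f'' (x r) / 2) (fun r hr => by
        rw [uIoc_of_le hss] at hr
        have := hη _ _ (hxε s hs r (Ioc_subset_Icc_self hr))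
        rw [← sub_div, norm_div, Real.norm_eq_abs]
        simp only [Real.norm_ofNat]
        linarith)
    rwa [abs_of_nonneg (sub_nonneg.2 hss)] at this
  have I3 := hK (s' - s) (sub_nonneg.2 hss) (x s)
  rw [intervalIntegral.integral_add j1 j2, centredIncr]
  rw [abs_le] at *
  constructor <;> linarith [I1.1, I1.2, I2.1, I2.2, I3.1, I3.2]

end IsTestFunction

/-- The `i`-th point of the uniform subdivision of `[a, t]` into `n` intervals. -/
def gridPt (a t : ℝ) (n i : ℕ) : ℝ := a + i * ((t - a) / n)

theorem gridPt_zero (a t : ℝ) (n : ℕ) : gridPt a t n 0 = a := by simp [gridPt]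

theorem gridPt_self (a t : ℝ) {n : ℕ} (hn : n ≠ 0) : gridPt a t n n = t := by
  rw [gridPt]; field_simp; ring

theorem gridPt_succ_sub (a t : ℝ) (n i : ℕ) :
    gridPt a t n (i + 1) - gridPt a t n i = (t - a) / n := by
  rw [gridPt, gridPt]; push_cast; ring

theorem gridPt_mono {a t : ℝ} (hat : a ≤ t) (n : ℕ) : Monotone (gridPt a t n) := by
  intro i j hij
  have : 0 ≤ (t - a) / n := div_nonneg (by linarith) (by positivity)
  unfold gridPt
  gcongr

theorem le_gridPt {a t : ℝ} (hat : a ≤ t) (n i : ℕ) : a ≤ gridPt a t n i := by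
  simpa [gridPt_zero] using gridPt_mono hat n (Nat.zero_le i)

theorem gridPt_le {a t : ℝ} (hat : a ≤ t) {n i : ℕ} (hn : n ≠ 0) (hi : i ≤ n) :
    gridPt a t n i ≤ t := by
  simpa [gridPt_self a t hn] using gridPt_mono hat n hi

theorem exists_modulus {x : ℝ → ℝ} (hx : Continuous x) (a t : ℝ) {ε : ℝ} (hε : 0 < ε) :
    ∃ δ > 0, ∀ r ∈ Icc a t, ∀ r' ∈ Icc a t, |r - r'| < δ → |x r - x r'| ≤ ε := by
  obtain ⟨δ, hδ, h⟩ := Metric.uniformContinuousOn_iff.1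
    ((isCompact_Icc (a := a) (b := t)).uniformContinuousOn_of_continuous hx.continuousOn) ε hε
  exact ⟨δ, hδ, fun r hr r' hr' hd => (h r hr r' hr' hd).le⟩

theorem intervalIntegral_grid {g : ℝ → ℝ} {a t : ℝ} (hat : a ≤ t)
    (hg : IntervalIntegrable g volume a t) {n : ℕ} (hn : n ≠ 0) :
    ∑ i ∈ Finset.range n, ∫ r in gridPt a t n i..gridPt a t n (i + 1), g r
      = ∫ r in a..t, g r := by
  rw [intervalIntegral.sum_integral_adjacent_intervals, gridPt_zero, gridPt_self a t hn]
  intro k hk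
  refine hg.mono_set ?_
  rw [uIcc_of_le hat, uIcc_of_le (gridPt_mono hat n k.le_succ)]
  exact Icc_subset_Icc (le_gridPt hat n k) (gridPt_le hat hn hk)

/-- Pathwise convergence of the compensated Riemann sums to the Itô remainder. -/
theorem IsTestFunction.tendsto_sum_centredIncr {f f' f'' : ℝ → ℝ} {C : ℝ}
    (hf : IsTestFunction f f' f'' C) {x w β : ℝ → ℝ} {a t : ℝ} (hat : a ≤ t)
    (hx : Continuous x) (hw : Continuous w) (hβ : IntervalIntegrable β volume a t)
    (heq : ∀ r ∈ Icc a t, x r = x a + (∫ s in a..r, β s) + (w r - w a)) :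
    Filter.Tendsto (fun n : ℕ => ∑ i ∈ Finset.range n,
      centredIncr f ((t - a) / n) (x (gridPt a t n i))
        (w (gridPt a t n (i + 1)) - w (gridPt a t n i))) Filter.atTop
      (nhds (f (x t) - f (x a) - ∫ r in a..t, (f' (x r) * β r + f'' (x r) / 2))) := by
  have hC := hf.nonneg
  have hV : 0 ≤ ∫ r in a..t, |β r| := intervalIntegral.integral_nonneg hat fun _ _ => abs_nonneg _
  rw [Metric.tendsto_atTop']
  intro e he
  set V := ∫ r in a..t, |β r|
  obtain ⟨η, hη, hηe⟩ : ∃ η > 0, η * (3 * C * V + 2 * (t - a) + 1) < e := by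
    have : 0 < 3 * C * V + 2 * (t - a) + 1 := by
      have := mul_nonneg hC hV
      linarith
    refine ⟨e / 2 / (3 * C * V + 2 * (t - a) + 1), by positivity, ?_⟩
    rw [div_mul_cancel₀ _ this.ne']
    linarith
  obtain ⟨K, hK0, hK⟩ := hf.gaussIncr_expansion hη
  obtain ⟨δ₀, hδ₀, hmod⟩ := Metric.uniformContinuous_iff.1 hf.uniformContinuous η hη
  set ε := min η (δ₀ / 2) with hεdef
  have hε : 0 < ε := lt_min hη (by positivity)
  obtain ⟨δ₁, hδ₁, hx'⟩ := exists_modulus hx a t hε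
  obtain ⟨δ₂, hδ₂, hw'⟩ := exists_modulus hw a t hε
  have lim : Filter.Tendsto (fun n : ℕ => (t - a) / n) Filter.atTop (nhds 0) :=
    tendsto_const_div_atTop_nhds_zero_nat _
  have lim2 : Filter.Tendsto (fun n : ℕ => K * (t - a) * √((t - a) / n)) Filter.atTop (nhds 0) := by
    simpa using (lim.sqrt).const_mul (K * (t - a))
  have ev := ((lim.eventually_lt_const hδ₁).and (lim.eventually_lt_const hδ₂)).and
    ((lim2.eventually_lt_const hη).and (Filter.eventually_ne_atTop 0))
  obtain ⟨N, hN⟩ := Filter.eventually_atTop.1 ev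
  refine ⟨N, fun n hn => ?_⟩
  obtain ⟨⟨h1, h2⟩, h3, hn0⟩ := hN n hn.le
  have hh : 0 ≤ (t - a) / n := div_nonneg (by linarith) (by positivity)
  have hn' : (n : ℝ) ≠ 0 := by exact_mod_cast hn0
  have tel : f (x t) - f (x a) - ∫ r in a..t, (f' (x r) * β r + f'' (x r) / 2)
      = ∑ i ∈ Finset.range n, (f (x (gridPt a t n (i + 1))) - f (x (gridPt a t n i))
        - ∫ r in gridPt a t n i..gridPt a t n (i + 1), (f' (x r) * β r + f'' (x r) / 2)) := by
    rw [Finset.sum_sub_distrib, Finset.sum_range_sub (fun i => f (x (gridPt a t n i))),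
      gridPt_zero, gridPt_self a t hn0, intervalIntegral_grid hat _ hn0]
    exact (hf.intervalIntegrable_comp_mul hx hβ).add (hf.intervalIntegrable_comp a t hx)
  rw [Real.dist_eq, tel, ← Finset.sum_sub_distrib]
  calc _ ≤ ∑ i ∈ Finset.range n,
        (3 * C * ε * (∫ r in gridPt a t n i..gridPt a t n (i + 1), |β r|)
        + (2 * η * ((t - a) / n) + K * ((t - a) / n * √((t - a) / n)))) := by
        refine (Finset.abs_sum_le_sum_abs _ _).trans (Finset.sum_le_sum fun i hi => ?_)
        have hi' : i + 1 ≤ n := Finset.mem_range.1 hi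
        have m0 := le_gridPt hat n i
        have m1 := gridPt_mono hat n i.le_succ
        have m2 := gridPt_le hat hn0 hi'
        have hd := gridPt_succ_sub a t n i
        have sub : Icc (gridPt a t n i) (gridPt a t n (i + 1)) ⊆ Icc a t := Icc_subset_Icc m0 m2
        have l := sub (left_mem_Icc.2 m1)
        have l' := sub (right_mem_Icc.2 m1)
        have hβ' : ∀ r ∈ Icc a t, ∀ r' ∈ Icc a t, IntervalIntegrable β volume r r' := by
          intro r hr r' hr'
          refine hβ.mono_set ?_
          rw [uIcc_of_le hat]
          exact uIcc_subset_Icc hr hr'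
        have ha := left_mem_Icc.2 hat
        have := hf.step_error (ε := ε) (η := η) (K := K) (β := β) m1 hx (hβ' _ l _ l')
          (w := w) (by
            have e1 := heq _ l
            have e2 := heq _ l'
            have := intervalIntegral.integral_add_adjacent_intervals (hβ' _ ha _ l) (hβ' _ l _ l')
            linarith)
          (fun r hr r' hr' => hx' r (sub hr) r' (sub hr') (by
            refine lt_of_le_of_lt ?_ h1
            rw [abs_le]
            constructor <;> linarith [hr.1, hr.2, hr'.1, hr'.2]))
          (hw' _ l' _ l (by rw [hd, abs_of_nonneg hh]; exact h2))
          (fun y z hyz => (hmod (show dist y z < δ₀ from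
            hyz.trans_lt ((min_le_right _ _).trans_lt (by linarith)))).le) hK
        rwa [hd] at this
    _ = 3 * C * ε * V + (2 * η * (t - a) + K * (t - a) * √((t - a) / n)) := by
        rw [Finset.sum_add_distrib, ← Finset.mul_sum, intervalIntegral_grid hat hβ.abs hn0]
        simp only [Finset.sum_const, Finset.card_range, nsmul_eq_mul]
        field_simp
        rfl
    _ ≤ 3 * C * η * V + (2 * η * (t - a) + η) := by
        have : ε ≤ η := min_le_left _ _
        gcongr
    _ = η * (3 * C * V + 2 * (t - a) + 1) := by ring
    _ < e := hηe

section Stochastic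

variable {Ω : Type*} {X B : ℝ → Ω → ℝ} {f f' f'' : ℝ → ℝ} {C a t : ℝ}

/-- The martingale of centred increments of `f` along a subdivision. -/
def centredSum (f : ℝ → ℝ) (X B : ℝ → Ω → ℝ) (a t : ℝ) (n k : ℕ) (ω : Ω) : ℝ :=
  ∑ i ∈ Finset.range k, centredIncr f ((t - a) / n) (X (gridPt a t n i) ω)
    (B (gridPt a t n (i + 1)) ω - B (gridPt a t n i) ω)

theorem IsTestFunction.abs_centredSum_le (hf : IsTestFunction f f' f'' C) (n k : ℕ) (ω : Ω) :
    |centredSum f X B a t n k ω| ≤ k * (4 * C) := by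
  refine (Finset.abs_sum_le_sum_abs _ _).trans ?_
  calc _ ≤ ∑ i ∈ Finset.range k, 4 * C :=
        Finset.sum_le_sum fun i _ => hf.abs_centredIncr_le _ _ _
    _ = _ := by simp

variable [m : MeasurableSpace Ω] {F : ℝ → MeasurableSpace Ω} {P : Measure Ω}

theorem IsTestFunction.measurable_centredSum (hf : IsTestFunction f f' f'' C)
    (hmono : ∀ s t, 0 ≤ s → s ≤ t → F s ≤ F t) (hB : IsBrownian F P B)
    (hX : ∀ t, 0 ≤ t → Measurable[F t] (X t)) (ha : 0 ≤ a) (hat : a ≤ t) (n k : ℕ) :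
    Measurable[F (gridPt a t n k)] (centredSum f X B a t n k) := by
  have h0 : ∀ i, 0 ≤ gridPt a t n i := fun i => ha.trans (le_gridPt hat n i)
  have hle : ∀ i ≤ k, F (gridPt a t n i) ≤ F (gridPt a t n k) := fun i hi =>
    hmono _ _ (h0 i) (gridPt_mono hat n hi)
  unfold centredSum
  refine Finset.measurable_fun_sum _ fun i hi => ?_
  have hi' := Finset.mem_range.1 hi
  exact (hf.measurable_centredIncr _).comp
    (((hX _ (h0 i)).mono (hle _ hi'.le) le_rfl).prodMk
      (((hB.2.2.1 _ (h0 _)).mono (hle _ hi') le_rfl).sub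
        ((hB.2.2.1 _ (h0 i)).mono (hle _ hi'.le) le_rfl)))

variable [IsProbabilityMeasure P]

/-- An increment of a Brownian motion is integrated out against an independent variable. -/
theorem IsBrownian.integral_comp_increment (hB : IsBrownian F P B) (hF : ∀ t, 0 ≤ t → F t ≤ m)
    {s t : ℝ} (hs : 0 ≤ s) (hst : s ≤ t) {E : Type*} [MeasurableSpace E] {W : Ω → E}
    (hW : Measurable[F s] W) {Ψ : E × ℝ → ℝ} (hΨ : Measurable Ψ) {K : ℝ} (hK : ∀ p, |Ψ p| ≤ K) :
    ∫ ω, Ψ (W ω, B t ω - B s ω) ∂P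
      = ∫ ω, ∫ y, Ψ (W ω, y) ∂(gaussianReal 0 (t - s).toNNReal) ∂P := by
  obtain ⟨-, -, hm, hind, hlaw⟩ := hB
  have hWm : Measurable W := hW.mono (hF s hs) le_rfl
  have hD : Measurable fun ω => B t ω - B s ω :=
    ((hm t (hs.trans hst)).mono (hF t (hs.trans hst)) le_rfl).sub
      ((hm s hs).mono (hF s hs) le_rfl)
  have hi : IndepFun W (fun ω => B t ω - B s ω) P := by
    rw [IndepFun_iff_Indep]
    exact (indep_of_indep_of_le_right (hind s t hs hst) hW.comap_le).symm
  have hmap := (indepFun_iff_map_prod_eq_prod_map_map hWm.aemeasurable hD.aemeasurable).1 hi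
  have : IsProbabilityMeasure (P.map W) := Measure.isProbabilityMeasure_map hWm.aemeasurable
  rw [hlaw s t hs hst] at hmap
  calc _ = ∫ p, Ψ p ∂(P.map fun ω => (W ω, B t ω - B s ω)) := by
        rw [integral_map (hWm.prodMk hD).aemeasurable hΨ.aestronglyMeasurable]
    _ = ∫ x, ∫ y, Ψ (x, y) ∂(gaussianReal 0 (t - s).toNNReal) ∂(P.map W) := by
        rw [hmap, integral_prod]
        exact .of_bound hΨ.aestronglyMeasurable K (ae_of_all _ hK)
    _ = _ := by
        rw [integral_map hWm.aemeasurable]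
        exact (StronglyMeasurable.integral_prod_right (f := fun x y => Ψ (x, y))
          hΨ.stronglyMeasurable).aestronglyMeasurable

theorem IsTestFunction.integral_mul_centredIncr (hf : IsTestFunction f f' f'' C)
    (hF : ∀ t, 0 ≤ t → F t ≤ m) (hB : IsBrownian F P B)
    (hX : ∀ t, 0 ≤ t → Measurable[F t] (X t)) {s s' : ℝ} (hs : 0 ≤ s) (hss : s ≤ s')
    {Z : Ω → ℝ} (hZ : Measurable[F s] Z) {K : ℝ} (hK : ∀ ω, |Z ω| ≤ K) :
    ∫ ω, Z ω * centredIncr f (s' - s) (X s ω) (B s' ω - B s ω) ∂P = 0 := by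
  have hC := hf.nonneg
  set c : ℝ → ℝ := fun z => max (-K) (min z K)
  have hKn : ∀ ω, c (Z ω) = Z ω := fun ω => by
    have := abs_le.1 (hK ω)
    simp only [c, min_eq_left this.2, max_eq_right this.1]
  have hc : ∀ z, |c z| ≤ |K| := fun z => by
    simp only [c]
    rcases le_total 0 K with h | h
    · rw [abs_of_nonneg h, abs_le]
      exact ⟨le_max_left _ _, max_le (by linarith) (min_le_right _ _)⟩
    · rw [max_eq_left ((min_le_right _ _).trans (by linarith)), abs_neg]
  have hcm : Measurable c := by fun_prop
  have := hB.integral_comp_increment hF hs hss (hZ.prodMk (hX s hs))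
    (Ψ := fun p => c p.1.1 * centredIncr f (s' - s) p.1.2 p.2)
    ((hcm.comp (measurable_fst.comp measurable_fst)).mul ((hf.measurable_centredIncr (s' - s)).comp
      ((measurable_snd.comp measurable_fst).prodMk measurable_snd)))
    (K := |K| * (4 * C)) (fun p => by
      rw [abs_mul]
      exact mul_le_mul (hc _) (hf.abs_centredIncr_le _ _ _) (abs_nonneg _) (abs_nonneg _))
  simp only [hKn] at this
  rw [this]
  simp only [integral_const_mul, hf.integral_centredIncr, mul_zero, integral_zero]

theorem IsTestFunction.integral_centredIncr_comp_sq_le (hf : IsTestFunction f f' f'' C)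
    (hF : ∀ t, 0 ≤ t → F t ≤ m) (hB : IsBrownian F P B)
    (hX : ∀ t, 0 ≤ t → Measurable[F t] (X t)) {s s' : ℝ} (hs : 0 ≤ s) (hss : s ≤ s') :
    ∫ ω, centredIncr f (s' - s) (X s ω) (B s' ω - B s ω) ^ 2 ∂P ≤ C ^ 2 * (s' - s) := by
  have hC := hf.nonneg
  have := hB.integral_comp_increment hF hs hss (hX s hs)
    (Ψ := fun p => centredIncr f (s' - s) p.1 p.2 ^ 2)
    ((hf.measurable_centredIncr (s' - s)).pow_const 2) (K := (4 * C) ^ 2) (fun p => by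
      rw [abs_pow]
      exact pow_le_pow_left₀ (abs_nonneg _) (hf.abs_centredIncr_le _ _ _) 2)
  rw [this]
  have h := norm_integral_le_of_norm_le_const (μ := P) (C := C ^ 2 * (s' - s)) (f := fun ω =>
    ∫ y, centredIncr f (s' - s) (X s ω) y ^ 2 ∂(gaussianReal 0 (s' - s).toNNReal))
    (ae_of_all _ fun ω => by
      rw [Real.norm_of_nonneg (integral_nonneg fun _ => sq_nonneg _)]
      exact hf.integral_centredIncr_sq_le (sub_nonneg.2 hss) _)
  refine (le_abs_self _).trans (h.trans ?_)
  simp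

theorem IsTestFunction.centredSum_moments (hf : IsTestFunction f f' f'' C)
    (hF : ∀ t, 0 ≤ t → F t ≤ m) (hmono : ∀ s t, 0 ≤ s → s ≤ t → F s ≤ F t)
    (hB : IsBrownian F P B) (hX : ∀ t, 0 ≤ t → Measurable[F t] (X t))
    (ha : 0 ≤ a) (hat : a ≤ t) {Z : Ω → ℝ} (hZ : Measurable[F a] Z) (hZ1 : ∀ ω, |Z ω| ≤ 1)
    (n k : ℕ) :
    ∫ ω, Z ω * centredSum f X B a t n k ω ∂P = 0 ∧
      ∫ ω, centredSum f X B a t n k ω ^ 2 ∂P ≤ C ^ 2 * (k * ((t - a) / n)) := by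
  have hC := hf.nonneg
  induction k with
  | zero => simp [centredSum]
  | succ k ih =>
    have h0 : 0 ≤ gridPt a t n k := ha.trans (le_gridPt hat n k)
    have h1 := gridPt_mono hat n k.le_succ
    have h2 := gridPt_succ_sub a t n k
    have mS := hf.measurable_centredSum hmono hB hX ha hat n k
    have mS' : Measurable (centredSum f X B a t n k) := mS.mono (hF _ h0) le_rfl
    have mZ' : Measurable Z := hZ.mono (hF _ ha) le_rfl
    have mI : Measurable fun ω => centredIncr f ((t - a) / n) (X (gridPt a t n k) ω)
        (B (gridPt a t n (k + 1)) ω - B (gridPt a t n k) ω) :=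
      (hf.measurable_centredIncr _).comp
        (((hX _ h0).mono (hF _ h0) le_rfl).prodMk
          (((hB.2.2.1 _ (h0.trans h1)).mono (hF _ (h0.trans h1)) le_rfl).sub
            ((hB.2.2.1 _ h0).mono (hF _ h0) le_rfl)))
    have e1 := hf.integral_mul_centredIncr hF hB hX h0 h1
      (hZ.mono (hmono _ _ ha (le_gridPt hat n k)) le_rfl) hZ1
    have e2 := hf.integral_mul_centredIncr hF hB hX h0 h1 mS
      (hf.abs_centredSum_le (X := X) (B := B) (a := a) (t := t) n k)
    have e3 := hf.integral_centredIncr_comp_sq_le hF hB hX h0 h1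
    rw [h2] at e1 e2 e3
    set D : Ω → ℝ := fun ω => centredIncr f ((t - a) / n) (X (gridPt a t n k) ω)
        (B (gridPt a t n (k + 1)) ω - B (gridPt a t n k) ω) with hD
    have bD : ∀ ω, |D ω| ≤ 4 * C := fun ω => hf.abs_centredIncr_le _ _ _
    have bS := hf.abs_centredSum_le (X := X) (B := B) (a := a) (t := t) n k
    have step : ∀ ω, centredSum f X B a t n (k + 1) ω = centredSum f X B a t n k ω + D ω :=
      fun ω => Finset.sum_range_succ _ _
    have bdd : ∀ {g : Ω → ℝ} {u v : ℝ} {g' : Ω → ℝ}, Measurable g → Measurable g' → 0 ≤ u →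
        (∀ ω, |g ω| ≤ u) → (∀ ω, |g' ω| ≤ v) → Integrable (fun ω => g ω * g' ω) P := by
      intro g u v g' hg hg' hu hgu hgv
      refine .of_bound (hg.mul hg').aestronglyMeasurable (u * v) (ae_of_all _ fun ω => ?_)
      rw [norm_mul]
      exact mul_le_mul (hgu ω) (hgv ω) (abs_nonneg _) hu
    have hk : 0 ≤ k * (4 * C) := by positivity
    constructor
    · simp only [step, mul_add]
      rw [integral_add (bdd mZ' mS' zero_le_one hZ1 bS) (bdd mZ' mI zero_le_one hZ1 bD), ih.1, e1,
        add_zero]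
    · have i1 := bdd mS' mS' hk bS bS
      have i2 := bdd mS' mI hk bS bD
      have i3 := bdd mI mI (by positivity) bD bD
      have : ∀ ω, centredSum f X B a t n (k + 1) ω ^ 2 = centredSum f X B a t n k ω
          * centredSum f X B a t n k ω + 2 * (centredSum f X B a t n k ω * D ω) + D ω * D ω := by
        intro ω; rw [step]; ring
      have i12 : Integrable (fun ω => centredSum f X B a t n k ω
          * centredSum f X B a t n k ω + 2 * (centredSum f X B a t n k ω * D ω)) P :=
        i1.add (i2.const_mul 2)
      simp only [this]
      rw [integral_add i12 i3, integral_add i1 (i2.const_mul 2), integral_const_mul, e2]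
      have ih2 : ∫ ω, centredSum f X B a t n k ω * centredSum f X B a t n k ω ∂P
          ≤ C ^ 2 * (k * ((t - a) / n)) := by
        simpa only [← pow_two] using ih.2
      have e3' : ∫ ω, D ω * D ω ∂P ≤ C ^ 2 * ((t - a) / n) := by
        simpa only [hD, ← pow_two] using e3
      push_cast
      linarith

/-- A bounded almost sure limit of centred, `L²`-bounded variables is centred. -/
theorem integral_mul_eq_zero_of_tendsto_ae {M : ℕ → Ω → ℝ} {N Z : Ω → ℝ} {K L : ℝ}
    (hM : ∀ n, Measurable (M n)) (hMb : ∀ n, ∃ c, ∀ ω, |M n ω| ≤ c) (hZ : Measurable Z)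
    (hZ1 : ∀ ω, |Z ω| ≤ 1) (h0 : ∀ n, ∫ ω, Z ω * M n ω ∂P = 0)
    (h2 : ∀ n, ∫ ω, M n ω ^ 2 ∂P ≤ L) (hN : ∀ᵐ ω ∂P, |N ω| ≤ K)
    (hlim : ∀ᵐ ω ∂P, Filter.Tendsto (fun n => M n ω) Filter.atTop (nhds (N ω))) :
    ∫ ω, Z ω * N ω ∂P = 0 := by
  have key : ∀ R, 0 < R → K ≤ R → |∫ ω, Z ω * N ω ∂P| ≤ L / R := by
    intro R hR hKR
    set c : ℝ → ℝ := fun z => max (-R) (min z R) with hcdef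
    have hcR : ∀ z, |c z| ≤ R := fun z =>
      abs_le.2 ⟨le_max_left _ _, max_le (by linarith) (min_le_right _ _)⟩
    have hcid : ∀ z, |z| ≤ R → c z = z := fun z hz => by
      have := abs_le.1 hz
      simp only [c, min_eq_left this.2, max_eq_right this.1]
    have hcc : Continuous c := by fun_prop
    have hcd : ∀ z, |c z - z| ≤ z ^ 2 / R := by
      intro z
      rw [le_div_iff₀ hR]
      by_cases hz : |z| ≤ R
      · rw [hcid z hz]; simp; positivity
      · rw [not_le] at hz
        have h3 : |c z - z| ≤ |z| := by
          rcases lt_abs.1 hz with h | h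
          · simp only [c, min_eq_right h.le, max_eq_right (by linarith : -R ≤ R)]
            rw [abs_of_neg (by linarith), abs_of_pos (by linarith)]; linarith
          · simp only [c, min_eq_left (by linarith : z ≤ R), max_eq_left (by linarith : z ≤ -R)]
            rw [abs_of_pos (by linarith), abs_of_neg (by linarith)]; linarith
        calc _ ≤ |z| * |z| := mul_le_mul h3 hz.le hR.le (abs_nonneg _)
          _ = z ^ 2 := by rw [← pow_two, sq_abs]
    have lim := tendsto_integral_of_dominated_convergence (μ := P)
      (F := fun n ω => Z ω * c (M n ω)) (f := fun ω => Z ω * N ω) (fun _ => R)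
      (fun n => (hZ.mul (hcc.measurable.comp (hM n))).aestronglyMeasurable)
      (integrable_const _) (fun n => ae_of_all _ fun ω => by
        rw [norm_mul]
        calc _ ≤ 1 * R := mul_le_mul (hZ1 ω) (hcR _) (abs_nonneg _) zero_le_one
          _ = R := one_mul R)
      (by
        filter_upwards [hN, hlim] with ω h1 h3
        have := (hcc.tendsto (N ω)).comp h3
        rw [hcid _ (h1.trans hKR)] at this
        exact this.const_mul _)
    refine le_of_tendsto lim.abs (Filter.Eventually.of_forall fun n => ?_)
    obtain ⟨b, hb⟩ := hMb n
    have hb' : ∀ ω, ‖M n ω ^ 2 / R‖ ≤ b ^ 2 / R := fun ω => by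
      rw [Real.norm_of_nonneg (by positivity), ← sq_abs]
      have := hb ω
      gcongr
    have hM2 : Integrable (fun ω => M n ω ^ 2 / R) P :=
      .of_bound (((hM n).pow_const 2).div_const R).aestronglyMeasurable _ (ae_of_all _ hb')
    have i1 : Integrable (fun ω => Z ω * c (M n ω)) P := by
      refine .of_bound (hZ.mul (hcc.measurable.comp (hM n))).aestronglyMeasurable (1 * R)
        (ae_of_all _ fun ω => ?_)
      rw [norm_mul]
      exact mul_le_mul (hZ1 ω) (hcR _) (abs_nonneg _) zero_le_one
    have i2 : Integrable (fun ω => Z ω * M n ω) P := by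
      refine .of_bound (hZ.mul (hM n)).aestronglyMeasurable (1 * b) (ae_of_all _ fun ω => ?_)
      rw [norm_mul]
      exact mul_le_mul (hZ1 ω) (hb _) (abs_nonneg _) zero_le_one
    rw [← sub_zero (∫ ω, Z ω * c (M n ω) ∂P), ← h0 n, ← integral_sub i1 i2, ← Real.norm_eq_abs]
    calc _ ≤ ∫ ω, M n ω ^ 2 / R ∂P := by
          refine norm_integral_le_of_norm_le hM2 (ae_of_all _ fun ω => ?_)
          rw [← mul_sub, norm_mul]
          calc _ ≤ 1 * (M n ω ^ 2 / R) :=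
                mul_le_mul (hZ1 ω) (hcd _) (abs_nonneg _) zero_le_one
            _ = _ := one_mul _
      _ = (∫ ω, M n ω ^ 2 ∂P) / R := integral_div _ _
      _ ≤ L / R := by have := h2 n; gcongr
  have lim : Filter.Tendsto (fun R : ℝ => L / R) Filter.atTop (nhds 0) :=
    Filter.Tendsto.const_div_atTop Filter.tendsto_id L
  have := ge_of_tendsto lim (by
    filter_upwards [Filter.eventually_gt_atTop 0, Filter.eventually_ge_atTop K] with R h h'
    exact key R h h')
  exact abs_nonpos_iff.1 this

/-- Itô's formula in expectation for `X = X_a + ∫ β + B - B_a`, where only `f' (X) β`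
is assumed bounded. -/
theorem IsTestFunction.ito (hf : IsTestFunction f f' f'' C)
    (hF : ∀ t, 0 ≤ t → F t ≤ m) (hmono : ∀ s t, 0 ≤ s → s ≤ t → F s ≤ F t)
    (hB : IsBrownian F P B) (hX : ∀ t, 0 ≤ t → Measurable[F t] (X t))
    (hXc : ∀ ω, Continuous fun t => X t ω) (ha : 0 ≤ a) (hat : a ≤ t)
    {Z : Ω → ℝ} (hZ : Measurable[F a] Z) (hZ1 : ∀ ω, |Z ω| ≤ 1) {β : ℝ → Ω → ℝ} {K : ℝ}
    (hK : ∀ r ∈ Icc a t, ∀ ω, |f' (X r ω) * β r ω| ≤ K)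
    (hsde : ∀ᵐ ω ∂P, IntervalIntegrable (fun r => β r ω) volume a t ∧
      ∀ r ∈ Icc a t, X r ω = X a ω + (∫ s in a..r, β s ω) + (B r ω - B a ω)) :
    ∫ ω, Z ω * (f (X t ω) - f (X a ω)
      - ∫ r in a..t, (f' (X r ω) * β r ω + f'' (X r ω) / 2)) ∂P = 0 := by
  have hC := hf.nonneg
  have mS : ∀ n k, Measurable (centredSum f X B a t n k) := fun n k =>
    (hf.measurable_centredSum hmono hB hX ha hat n k).mono (hF _ (ha.trans (le_gridPt hat n k)))
      le_rfl
  have mom := hf.centredSum_moments hF hmono hB hX ha hat hZ hZ1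
  refine integral_mul_eq_zero_of_tendsto_ae (M := fun n => centredSum f X B a t n n)
    (K := 2 * C + (K + C / 2) * (t - a)) (L := C ^ 2 * (t - a))
    (fun n => mS n n) (fun n => ⟨_, hf.abs_centredSum_le n n⟩) (hZ.mono (hF a ha) le_rfl) hZ1
    (fun n => (mom n n).1) (fun n => (mom n n).2.trans ?_) (ae_of_all _ fun ω => ?_) ?_
  · rcases eq_or_ne n 0 with rfl | hn
    · simp only [Nat.cast_zero, zero_mul, mul_zero]
      have := sub_nonneg.2 hat
      positivity
    · have : (n : ℝ) ≠ 0 := by exact_mod_cast hn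
      rw [mul_div_cancel₀ _ this]
  · have h1 := intervalIntegral.norm_integral_le_of_norm_le_const (a := a) (b := t)
      (C := K + C / 2) (f := fun r => f' (X r ω) * β r ω + f'' (X r ω) / 2) (fun r hr => by
        rw [uIoc_of_le hat] at hr
        refine (norm_add_le _ _).trans (add_le_add (hK r (Ioc_subset_Icc_self hr) ω) ?_)
        rw [norm_div, Real.norm_ofNat]
        have := hf.bound'' (X r ω)
        rw [Real.norm_eq_abs]
        gcongr)
    rw [abs_of_nonneg (sub_nonneg.2 hat), Real.norm_eq_abs] at h1
    have h2 := abs_sub (f (X t ω) - f (X a ω))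
      (∫ r in a..t, (f' (X r ω) * β r ω + f'' (X r ω) / 2))
    have h3 := abs_sub (f (X t ω)) (f (X a ω))
    linarith [hf.bound (X t ω), hf.bound (X a ω)]
  · filter_upwards [hsde] with ω hω
    simp only [centredSum]
    exact hf.tendsto_sum_centredIncr (x := fun r => X r ω) (w := fun r => B r ω)
      (β := fun r => β r ω) hat (hXc ω) (hB.1 ω) hω.1 hω.2

end Stochastic

theorem hasDerivAt_max_zero_pow (n : ℕ) (u : ℝ) :
    HasDerivAt (fun v : ℝ => max v 0 ^ (n + 2)) ((n + 2) * max u 0 ^ (n + 1)) u := by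
  have hp : HasDerivAt (fun v : ℝ => v ^ (n + 2)) ((n + 2) * u ^ (n + 1)) u := by
    simpa using hasDerivAt_pow (n + 2) u
  rcases lt_trichotomy u 0 with h | rfl | h
  · rw [max_eq_right h.le, zero_pow n.succ_ne_zero, mul_zero]
    refine (hasDerivAt_const u (0 : ℝ)).congr_of_eventuallyEq ?_
    filter_upwards [eventually_lt_nhds h] with v hv
    rw [max_eq_right hv.le, zero_pow (by omega)]
  · rw [max_self, ← hasDerivWithinAt_univ, ← Iic_union_Ici (a := (0 : ℝ))]
    refine HasDerivWithinAt.union ?_ ?_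
    · rw [zero_pow n.succ_ne_zero, mul_zero]
      refine (hasDerivWithinAt_const (0 : ℝ) _ (0 : ℝ)).congr (fun v hv => ?_) (by simp)
      rw [max_eq_right hv, zero_pow (by omega)]
    · refine hp.hasDerivWithinAt.congr (fun v hv => ?_) (by simp)
      rw [max_eq_left hv]
  · rw [max_eq_left h.le]
    refine hp.congr_of_eventuallyEq ?_
    filter_upwards [eventually_gt_nhds h] with v hv
    rw [max_eq_left hv.le]

/-- `h` is twice continuously differentiable on `[0, ∞)`, with derivatives `h'` and `h''`,
and vanishes on `[1, ∞)`. -/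
structure IsProfile (h h' h'' : ℝ → ℝ) : Prop where
  hasDerivAt : ∀ y, 0 ≤ y → HasDerivAt h (h' y) y
  hasDerivAt' : ∀ y, 0 ≤ y → HasDerivAt h' (h'' y) y
  continuousOn : ContinuousOn h'' (Ici 0)
  eq_zero : ∀ y, 1 ≤ y → h y = 0
  eq_zero' : ∀ y, 1 ≤ y → h' y = 0
  eq_zero'' : ∀ y, 1 ≤ y → h'' y = 0

/-- The generator of the diffusion with drift `bCE` at times `t ≥ 2`, applied to `x ↦ h (x ^ 2)`
for a profile `h`. -/
def generatorSq (h' h'' : ℝ → ℝ) (x : ℝ) : ℝ :=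
  if x = 0 then h' 0 else 2 * x ^ 2 * h'' (x ^ 2)

namespace IsProfile

variable {h h' h'' : ℝ → ℝ}

theorem continuous_comp_sq' (hh : IsProfile h h' h'') : Continuous fun x => h' (x ^ 2) :=
  ContinuousOn.comp_continuous (s := Ici 0)
    (fun y hy => (hh.hasDerivAt' y hy).continuousAt.continuousWithinAt) (by fun_prop)
    fun x => sq_nonneg x

theorem continuous_comp_sq'' (hh : IsProfile h h' h'') : Continuous fun x => h'' (x ^ 2) :=
  hh.continuousOn.comp_continuous (by fun_prop) fun x => sq_nonneg x

theorem exists_isTestFunction (hh : IsProfile h h' h'') :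
    ∃ C, IsTestFunction (fun x => h (x ^ 2)) (fun x => 2 * x * h' (x ^ 2))
      (fun x => 2 * h' (x ^ 2) + 4 * x ^ 2 * h'' (x ^ 2)) C := by
  have one_le : ∀ x : ℝ, 1 ≤ |x| → 1 ≤ x ^ 2 := fun x hx => (one_le_sq_iff_one_le_abs x).2 hx
  have hc' := hh.continuous_comp_sq'
  have hc'' := hh.continuous_comp_sq''
  have hsq : ∀ x : ℝ, HasDerivAt (fun x : ℝ => x ^ 2) (2 * x) x := fun x => by
    simpa using hasDerivAt_pow 2 x
  have hd : ∀ x : ℝ, HasDerivAt (fun x => h (x ^ 2)) (h' (x ^ 2) * (2 * x)) x := fun x =>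
    HasDerivAt.comp (h := fun x => x ^ 2) x (hh.hasDerivAt _ (sq_nonneg x)) (hsq x)
  have hd' : ∀ x : ℝ, HasDerivAt (fun x => h' (x ^ 2)) (h'' (x ^ 2) * (2 * x)) x := fun x =>
    HasDerivAt.comp (h := fun x => x ^ 2) x (hh.hasDerivAt' _ (sq_nonneg x)) (hsq x)
  refine _root_.exists_isTestFunction (fun x => ?_) (fun x => ?_)
    ((hc'.const_mul 2).add (((continuous_pow 2).const_mul 4).mul hc'')) (fun x hx => ?_)
    (fun x hx => ?_) (fun x hx => ?_)
  · refine HasDerivAt.congr_deriv (hd x) ?_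
    ring
  · refine HasDerivAt.congr_deriv (((hasDerivAt_id' x).const_mul 2).fun_mul (hd' x)) ?_
    ring
  · exact hh.eq_zero _ (one_le x hx)
  · rw [hh.eq_zero' _ (one_le x hx), mul_zero]
  · rw [hh.eq_zero' _ (one_le x hx), hh.eq_zero'' _ (one_le x hx)]
    ring

theorem exists_abs_le' (hh : IsProfile h h' h'') : ∃ K, ∀ x, |h' (x ^ 2)| ≤ K :=
  exists_abs_le_of_eq_zero_off_Icc hh.continuous_comp_sq'
    fun x hx => hh.eq_zero' _ ((one_le_sq_iff_one_le_abs x).2 hx)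

theorem deriv_mul_bCE (hh : IsProfile h h' h'') {r : ℝ} (hr : 2 ≤ r) (x : ℝ) :
    2 * x * h' (x ^ 2) * bCE r x = if x = 0 then 0 else -h' (x ^ 2) := by
  have hr1 : ¬ r < 1 := by linarith
  have hr2 : ¬ r < 2 := by linarith
  split_ifs with hx
  · simp [hx]
  by_cases h1 : |x| ≤ 1
  · have h3 : ¬ 1 < x := not_lt.2 (abs_le.1 h1).2
    have h4 : ¬ x < -1 := not_lt.2 (abs_le.1 h1).1
    simp only [bCE, hr1, hr2, h1, h3, h4, hx, if_true, if_false, ne_eq, not_false_eq_true,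
      and_self, add_zero]
    field_simp
  · rw [hh.eq_zero' _ ((one_le_sq_iff_one_le_abs x).2 (not_le.1 h1).le)]
    simp

theorem generator_eq (hh : IsProfile h h' h'') {r : ℝ} (hr : 2 ≤ r) (x : ℝ) :
    2 * x * h' (x ^ 2) * bCE r x + (2 * h' (x ^ 2) + 4 * x ^ 2 * h'' (x ^ 2)) / 2
      = generatorSq h' h'' x := by
  rw [hh.deriv_mul_bCE hr, generatorSq]
  split_ifs with hx
  · simp [hx]
  · ring

theorem measurable_generatorSq (hh : IsProfile h h' h'') : Measurable (generatorSq h' h'') := by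
  have := hh.continuous_comp_sq''
  exact Measurable.ite (measurableSet_singleton 0) measurable_const
    (((continuous_pow 2).const_mul 2).mul this).measurable

theorem exists_abs_generatorSq_le (hh : IsProfile h h' h'') :
    ∃ K, ∀ x, |generatorSq h' h'' x| ≤ K := by
  obtain ⟨C, hC⟩ := hh.exists_isTestFunction
  obtain ⟨K, hK⟩ := hh.exists_abs_le'
  refine ⟨K + C / 2, fun x => ?_⟩
  rw [← hh.generator_eq le_rfl, hh.deriv_mul_bCE le_rfl]
  refine (abs_add_le _ _).trans (add_le_add ?_ ?_)
  · split_ifs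
    · simpa using (abs_nonneg _).trans (hK x)
    · simpa using hK x
  · rw [abs_div, abs_two]
    have := hC.bound'' x
    gcongr

end IsProfile

/-- The profile `c (1 - y / c)₊ ^ 3`. -/
theorem isProfile_bump {c : ℝ} (hc : 0 < c) (hc1 : c ≤ 1) :
    IsProfile (fun y => c * max (1 - y / c) 0 ^ 3) (fun y => -3 * max (1 - y / c) 0 ^ 2)
      (fun y => 6 / c * max (1 - y / c) 0) := by
  have hd : ∀ y, HasDerivAt (fun y => 1 - y / c) (-(1 / c)) y := fun y =>
    ((hasDerivAt_id y).div_const c).const_sub 1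
  have hz : ∀ y, 1 ≤ y → max (1 - y / c) 0 = 0 := fun y hy =>
    max_eq_right (sub_nonpos.2 ((one_le_div hc).2 (hc1.trans hy)))
  have hd2 : ∀ n : ℕ, ∀ y, HasDerivAt (fun y => max (1 - y / c) 0 ^ (n + 2))
      ((n + 2) * max (1 - y / c) 0 ^ (n + 1) * -(1 / c)) y := fun n y =>
    HasDerivAt.comp (h := fun y => 1 - y / c) y (hasDerivAt_max_zero_pow n (1 - y / c)) (hd y)
  refine ⟨fun y _ => ?_, fun y _ => ?_, by fun_prop, fun y hy => ?_, fun y hy => ?_, fun y hy => ?_⟩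
  · refine HasDerivAt.congr_deriv ((hd2 1 y).const_mul c) ?_
    push_cast
    field_simp
    ring
  · refine HasDerivAt.congr_deriv ((hd2 0 y).const_mul (-3)) ?_
    push_cast
    field_simp
    ring
  all_goals simp [hz y hy]

/-- The profile `(1 - √(y + c))₊ ^ 3`. -/
theorem isProfile_sqrt {c : ℝ} (hc : 0 < c) :
    IsProfile (fun y => max (1 - √(y + c)) 0 ^ 3)
      (fun y => -(3 / 2) * (max (1 - √(y + c)) 0 ^ 2 / √(y + c)))
      (fun y => 3 / 2 * (max (1 - √(y + c)) 0 / √(y + c) ^ 2)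
        + 3 / 4 * (max (1 - √(y + c)) 0 ^ 2 / √(y + c) ^ 3)) := by
  have hs : ∀ y, 0 ≤ y → √(y + c) ≠ 0 := fun y hy => (Real.sqrt_pos.2 (by linarith)).ne'
  have hd : ∀ y, 0 ≤ y → HasDerivAt (fun y => √(y + c)) (1 / (2 * √(y + c))) y := fun y hy =>
    ((hasDerivAt_id y).add_const c).sqrt (by simp only [id]; linarith)
  have hz : ∀ y, 1 ≤ y → max (1 - √(y + c)) 0 = 0 := fun y hy =>
    max_eq_right (sub_nonpos.2 (Real.one_le_sqrt.2 (by linarith)))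
  have hd2 : ∀ n : ℕ, ∀ y, 0 ≤ y → HasDerivAt (fun y => max (1 - √(y + c)) 0 ^ (n + 2))
      ((n + 2) * max (1 - √(y + c)) 0 ^ (n + 1) * -(1 / (2 * √(y + c)))) y := fun n y hy =>
    HasDerivAt.comp (h := fun y => 1 - √(y + c)) y (hasDerivAt_max_zero_pow n (1 - √(y + c)))
      ((hd y hy).const_sub 1)
  refine ⟨fun y hy => ?_, fun y hy => ?_, ?_, fun y hy => ?_, fun y hy => ?_, fun y hy => ?_⟩
  · refine HasDerivAt.congr_deriv (hd2 1 y hy) ?_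
    push_cast
    ring
  · refine HasDerivAt.congr_deriv (((hd2 0 y hy).fun_div (hd y hy) (hs y hy)).const_mul (-(3 / 2))) ?_
    have := hs y hy
    push_cast
    field_simp
    ring
  · have : ∀ y ∈ Ici (0 : ℝ), √(y + c) ≠ 0 := hs
    refine ContinuousOn.add (continuousOn_const.mul (ContinuousOn.div (by fun_prop) (by fun_prop)
      fun y hy => pow_ne_zero _ (hs y hy))) (continuousOn_const.mul (ContinuousOn.div (by fun_prop)
      (by fun_prop) fun y hy => pow_ne_zero _ (hs y hy)))
  all_goals simp [hz y hy]

theorem abs_generatorSq_bump_le {c : ℝ} (hc : 0 < c) (x : ℝ) :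
    |generatorSq (fun y => -3 * max (1 - y / c) 0 ^ 2) (fun y => 6 / c * max (1 - y / c) 0) x|
      ≤ 12 := by
  unfold generatorSq
  split_ifs
  · norm_num
  · simp only
    rw [abs_of_nonneg (by positivity)]
    rcases le_total (1 - x ^ 2 / c) 0 with h | h
    · rw [max_eq_right h]; norm_num
    · rw [max_eq_left h]
      have h1 : 0 ≤ x ^ 2 / c := by positivity
      have : 2 * x ^ 2 * (6 / c * (1 - x ^ 2 / c)) = 12 * (x ^ 2 / c * (1 - x ^ 2 / c)) := by ring
      rw [this]
      nlinarith

theorem le_generatorSq_sqrt {c : ℝ} (hc : 0 < c) {x : ℝ} (hx : x ≠ 0) :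
    3 * (x ^ 2 / (x ^ 2 + c)) * max (1 - √(x ^ 2 + c)) 0 ^ 3 ≤
      generatorSq (fun y => -(3 / 2) * (max (1 - √(y + c)) 0 ^ 2 / √(y + c)))
      (fun y => 3 / 2 * (max (1 - √(y + c)) 0 / √(y + c) ^ 2)
        + 3 / 4 * (max (1 - √(y + c)) 0 ^ 2 / √(y + c) ^ 3)) x := by
  have hp0 : 0 ≤ max (1 - √(x ^ 2 + c)) 0 := le_max_right _ _
  have hp1 : max (1 - √(x ^ 2 + c)) 0 ≤ 1 :=
    max_le (by linarith [Real.sqrt_nonneg (x ^ 2 + c)]) zero_le_one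
  have hs : √(x ^ 2 + c) ^ 2 = x ^ 2 + c := Real.sq_sqrt (by positivity)
  simp only [generatorSq, if_neg hx, hs]
  have h3 : max (1 - √(x ^ 2 + c)) 0 ^ 3 ≤ max (1 - √(x ^ 2 + c)) 0 :=
    pow_le_of_le_one hp0 hp1 (by norm_num)
  calc _ ≤ 3 * (x ^ 2 / (x ^ 2 + c)) * max (1 - √(x ^ 2 + c)) 0 := by gcongr
    _ = 2 * x ^ 2 * (3 / 2 * (max (1 - √(x ^ 2 + c)) 0 / (x ^ 2 + c)) + 0) := by ring
    _ ≤ _ := by gcongr; positivity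

section Paths

variable {Ω : Type*} {X : ℝ → Ω → ℝ} {a t : ℝ}

theorem intervalIntegral_comp_max_zero (G : ℝ → ℝ) (ha : 0 ≤ a) (hat : a ≤ t) (ω : Ω) :
    ∫ r in a..t, G (X r ω) = ∫ r in Ioc a t, G (X (max r 0) ω) := by
  rw [intervalIntegral.integral_of_le hat]
  refine setIntegral_congr_fun measurableSet_Ioc fun r hr => ?_
  simp only [max_eq_left (ha.trans hr.1.le)]

theorem abs_intervalIntegral_comp_le (hat : a ≤ t) {G : ℝ → ℝ} {K : ℝ} (hK : ∀ x, |G x| ≤ K)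
    (ω : Ω) : |∫ r in a..t, G (X r ω)| ≤ K * (t - a) := by
  have := intervalIntegral.norm_integral_le_of_norm_le_const (a := a) (b := t)
    (C := K) (f := fun r => G (X r ω)) fun r _ => hK _
  rwa [abs_of_nonneg (sub_nonneg.2 hat)] at this

theorem intervalIntegrable_comp (hXc : ∀ ω, Continuous fun t => X t ω) {G : ℝ → ℝ}
    (hG : Measurable G) {K : ℝ} (hK : ∀ x, |G x| ≤ K) (ω : Ω) :
    IntervalIntegrable (fun r => G (X r ω)) volume a t :=
  (intervalIntegrable_const (c := K)).mono_fun (hG.comp (hXc ω).measurable).aestronglyMeasurable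
    (ae_of_all _ fun _ => (hK _).trans (le_abs_self K))

/-- The functional of the path whose expectation is controlled by Itô's formula. -/
def pathFunctional (X : ℝ → Ω → ℝ) (a t : ℝ) (H G : ℝ → ℝ) (ω : Ω) : ℝ :=
  H (X t ω) - H (X a ω) - ∫ r in a..t, G (X r ω)

theorem abs_pathFunctional_le (hat : a ≤ t) {H G : ℝ → ℝ} {K L : ℝ} (hK : ∀ x, |H x| ≤ K)
    (hL : ∀ x, |G x| ≤ L) (ω : Ω) : |pathFunctional X a t H G ω| ≤ 2 * K + L * (t - a) := by
  have h1 := abs_intervalIntegral_comp_le (X := X) hat hL ω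
  have h2 := abs_sub (H (X t ω) - H (X a ω)) (∫ r in a..t, G (X r ω))
  have h3 := abs_sub (H (X t ω)) (H (X a ω))
  unfold pathFunctional
  linarith [hK (X t ω), hK (X a ω)]

variable [m : MeasurableSpace Ω] {P : Measure Ω}

theorem measurable_uncurry_max_zero (hX : ∀ t, 0 ≤ t → Measurable (X t))
    (hXc : ∀ ω, Continuous fun t => X t ω) : Measurable fun p : Ω × ℝ => X (max p.2 0) p.1 :=
  (measurable_uncurry_of_continuous_of_measurable (u := fun r ω => X (max r 0) ω)
    (fun ω => (hXc ω).comp (by fun_prop)) fun r => hX _ (le_max_right r 0)).comp measurable_swap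

theorem measurable_intervalIntegral_comp (hX : ∀ t, 0 ≤ t → Measurable (X t))
    (hXc : ∀ ω, Continuous fun t => X t ω) (ha : 0 ≤ a) (hat : a ≤ t) {G : ℝ → ℝ}
    (hG : Measurable G) : Measurable fun ω => ∫ r in a..t, G (X r ω) := by
  simp only [intervalIntegral_comp_max_zero G ha hat]
  exact ((hG.comp (measurable_uncurry_max_zero hX hXc)).stronglyMeasurable.integral_prod_right
    (f := fun ω r => G (X (max r 0) ω))).measurable

theorem measurable_pathFunctional (hX : ∀ t, 0 ≤ t → Measurable (X t))
    (hXc : ∀ ω, Continuous fun t => X t ω) (ha : 0 ≤ a) (hat : a ≤ t) {H G : ℝ → ℝ}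
    (hH : Measurable H) (hG : Measurable G) : Measurable (pathFunctional X a t H G) :=
  ((hH.comp (hX t (ha.trans hat))).sub (hH.comp (hX a ha))).sub
    (measurable_intervalIntegral_comp hX hXc ha hat hG)

theorem integrable_mul_pathFunctional [IsProbabilityMeasure P]
    (hX : ∀ t, 0 ≤ t → Measurable (X t))
    (hXc : ∀ ω, Continuous fun t => X t ω) (ha : 0 ≤ a) (hat : a ≤ t) {H G : ℝ → ℝ}
    (hH : Measurable H) (hG : Measurable G) {K L : ℝ} (hK : ∀ x, |H x| ≤ K)
    (hL : ∀ x, |G x| ≤ L) {Z : Ω → ℝ} (hZ : Measurable Z) (hZ1 : ∀ ω, |Z ω| ≤ 1) :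
    Integrable (fun ω => Z ω * pathFunctional X a t H G ω) P := by
  refine .of_bound (hZ.mul (measurable_pathFunctional hX hXc ha hat hH hG)).aestronglyMeasurable
    (1 * (2 * K + L * (t - a))) (ae_of_all _ fun ω => ?_)
  rw [norm_mul]
  exact mul_le_mul (hZ1 ω) (abs_pathFunctional_le hat hK hL ω) (abs_nonneg _) zero_le_one

theorem tendsto_integral_mul_pathFunctional [IsProbabilityMeasure P]
    (hX : ∀ t, 0 ≤ t → Measurable (X t))
    (hXc : ∀ ω, Continuous fun t => X t ω) (ha : 0 ≤ a) (hat : a ≤ t) {H G : ℕ → ℝ → ℝ}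
    (hH : ∀ n, Measurable (H n)) (hG : ∀ n, Measurable (G n)) {K L : ℝ}
    (hK : ∀ n x, |H n x| ≤ K) (hL : ∀ n x, |G n x| ≤ L) {H' G' : ℝ → ℝ}
    (hlim : ∀ x, Filter.Tendsto (fun n => H n x) Filter.atTop (nhds (H' x)))
    (hlim' : ∀ᵐ ω ∂P, ∀ᵐ r ∂volume, r ∈ Ioc a t →
      Filter.Tendsto (fun n => G n (X r ω)) Filter.atTop (nhds (G' (X r ω))))
    {Z : Ω → ℝ} (hZ : Measurable Z) (hZ1 : ∀ ω, |Z ω| ≤ 1) :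
    Filter.Tendsto (fun n => ∫ ω, Z ω * pathFunctional X a t (H n) (G n) ω ∂P) Filter.atTop
      (nhds (∫ ω, Z ω * pathFunctional X a t H' G' ω ∂P)) := by
  refine tendsto_integral_of_dominated_convergence (fun _ => 1 * (2 * K + L * (t - a)))
    (fun n => (hZ.mul (measurable_pathFunctional hX hXc ha hat (hH n) (hG n))).aestronglyMeasurable)
    (integrable_const _) (fun n => ae_of_all _ fun ω => ?_) ?_
  · rw [norm_mul]
    exact mul_le_mul (hZ1 ω) (abs_pathFunctional_le hat (hK n) (hL n) ω) (abs_nonneg _) zero_le_one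
  · filter_upwards [hlim'] with ω hω
    refine (((hlim _).sub (hlim _)).sub ?_).const_mul _
    refine intervalIntegral.tendsto_integral_filter_of_dominated_convergence (fun _ => L)
      (Filter.Eventually.of_forall fun n =>
        ((hG n).comp (hXc ω).measurable).aestronglyMeasurable)
      (Filter.Eventually.of_forall fun n => ae_of_all _ fun r _ => hL n _)
      intervalIntegrable_const ?_
    rwa [uIoc_of_le hat]

end Paths

section BCE

variable {Ω : Type*} [m : MeasurableSpace Ω] {F : ℝ → MeasurableSpace Ω} {P : Measure Ω}
  {X B : ℝ → Ω → ℝ} {x₀ : Ω → ℝ} {T : ℝ}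

theorem IsWeakSolutionOn.ae_eq_add_integral {b : ℝ → ℝ → ℝ}
    (hS : IsWeakSolutionOn F P b X B x₀ T) {a t : ℝ} (ha : 0 ≤ a) (hat : a ≤ t) (ht : t ≤ T) :
    ∀ᵐ ω ∂P, IntervalIntegrable (fun r => b r (X r ω)) volume a t ∧
      ∀ r ∈ Icc a t, X r ω = X a ω + (∫ s in a..r, b s (X s ω)) + (B r ω - B a ω) := by
  obtain ⟨-, -, -, -, -, -, h⟩ := hS
  filter_upwards [h] with ω hω
  have hi : ∀ r ∈ Icc a t, IntervalIntegrable (fun s => b s (X s ω)) volume 0 r := fun r hr => by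
    rw [intervalIntegrable_iff_integrableOn_Icc_of_le (ha.trans hr.1)]
    exact (hω r ⟨ha.trans hr.1, hr.2.trans ht⟩).1
  have h0 := hi a ⟨le_rfl, hat⟩
  refine ⟨h0.symm.trans (hi t ⟨hat, le_rfl⟩), fun r hr => ?_⟩
  rw [(hω r ⟨ha.trans hr.1, hr.2.trans ht⟩).2, (hω a ⟨ha, hat.trans ht⟩).2,
    ← intervalIntegral.integral_add_adjacent_intervals h0 (h0.symm.trans (hi r hr))]
  ring

variable [IsProbabilityMeasure P]

theorem IsWeakSolutionOn.integral_mul_pathFunctional_eq_zero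
    (hS : IsWeakSolutionOn F P bCE X B x₀ 3) {h h' h'' : ℝ → ℝ} (hh : IsProfile h h' h'') {t : ℝ}
    (ht : t ∈ Icc (2 : ℝ) 3) {Z : Ω → ℝ} (hZ : Measurable[F 2] Z) (hZ1 : ∀ ω, |Z ω| ≤ 1) :
    ∫ ω, Z ω * pathFunctional X 2 t (fun x => h (x ^ 2)) (generatorSq h' h'') ω ∂P = 0 := by
  have hsde := hS.ae_eq_add_integral zero_le_two ht.1 ht.2
  obtain ⟨hF, hmono, hB, hXc, hX, -, -⟩ := hS
  obtain ⟨C, hC⟩ := hh.exists_isTestFunction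
  obtain ⟨K, hK⟩ := hh.exists_abs_le'
  have := hC.ito hF hmono hB hX hXc zero_le_two ht.1 hZ hZ1 (β := fun r ω => bCE r (X r ω)) (K := K)
    (fun r hr ω => ?_) hsde
  · refine (integral_congr_ae (ae_of_all _ fun ω => ?_)).trans this
    simp only [pathFunctional]
    congr 2
    refine intervalIntegral.integral_congr fun r hr => ?_
    rw [uIcc_of_le ht.1] at hr
    exact (hh.generator_eq hr.1 _).symm
  · simp only [hh.deriv_mul_bCE hr.1]
    split_ifs
    · simpa using (abs_nonneg _).trans (hK 0)
    · simpa using hK _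

/-- After time `2` a weak solution spends no time at the origin. -/
theorem IsWeakSolutionOn.ae_ne_zero (hS : IsWeakSolutionOn F P bCE X B x₀ 3) :
    ∀ᵐ ω ∂P, ∀ᵐ r ∂volume, r ∈ Ioc (2 : ℝ) 3 → X r ω ≠ 0 := by
  have hzero := fun n : ℕ => hS.integral_mul_pathFunctional_eq_zero
    (isProfile_bump (c := 1 / ((n : ℝ) + 1)) (by positivity)
      ((div_le_one (by positivity)).2 (by linarith [(n.cast_nonneg : (0 : ℝ) ≤ n)])))
    (t := 3) (by norm_num) (Z := fun _ => 1) measurable_const (by simp)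
  obtain ⟨hF, -, -, hXc, hX, -, -⟩ := hS
  have hXm : ∀ t, 0 ≤ t → Measurable (X t) := fun t ht => (hX t ht).mono (hF t ht) le_rfl
  have hc0 : Filter.Tendsto (fun n : ℕ => 1 / ((n : ℝ) + 1)) Filter.atTop (nhds 0) :=
    tendsto_one_div_add_atTop_nhds_zero_nat
  set c : ℕ → ℝ := fun n => 1 / ((n : ℝ) + 1)
  have hc : ∀ n, 0 < c n := fun n => by positivity
  have hc1 : ∀ n, c n ≤ 1 := fun n =>
    (div_le_one (by positivity)).2 (by linarith [(n.cast_nonneg : (0 : ℝ) ≤ n)])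
  have hHb : ∀ n x, |c n * max (1 - x ^ 2 / c n) 0 ^ 3| ≤ c n := fun n x => by
    have : max (1 - x ^ 2 / c n) 0 ≤ 1 :=
      max_le (sub_le_self _ (div_nonneg (sq_nonneg x) (hc n).le)) zero_le_one
    rw [abs_of_nonneg (mul_nonneg (hc n).le (by positivity))]
    exact mul_le_of_le_one_right (hc n).le (pow_le_one₀ (le_max_right _ _) this)
  have hlim := tendsto_integral_mul_pathFunctional (P := P) hXm hXc zero_le_two
    (show (2 : ℝ) ≤ 3 by norm_num)
    (H := fun n x => c n * max (1 - x ^ 2 / c n) 0 ^ 3)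
    (G := fun n => generatorSq (fun y => -3 * max (1 - y / c n) 0 ^ 2)
      (fun y => 6 / c n * max (1 - y / c n) 0))
    (fun n => by fun_prop) (fun n => (isProfile_bump (hc n) (hc1 n)).measurable_generatorSq)
    (fun n x => (hHb n x).trans (hc1 n)) (fun n x => abs_generatorSq_bump_le (hc n) x)
    (H' := fun _ => 0) (G' := fun x => if x = 0 then -3 else 0)
    (fun x => squeeze_zero_norm (fun n => hHb n x) hc0)
    (ae_of_all _ fun ω => ae_of_all _ fun r _ => ?_)
    (Z := fun _ => 1) measurable_const (by simp)
  · have h0 := tendsto_nhds_unique hlim (tendsto_const_nhds.congr fun n => (hzero n).symm)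
    have hGm : Measurable fun x : ℝ => if x = 0 then (-3 : ℝ) else 0 :=
      Measurable.ite (measurableSet_singleton 0) measurable_const measurable_const
    have hGb : ∀ x : ℝ, |if x = 0 then (-3 : ℝ) else 0| ≤ 3 := fun x => by split_ifs <;> norm_num
    have hint := integrable_mul_pathFunctional (P := P) hXm hXc zero_le_two
      (show (2 : ℝ) ≤ 3 by norm_num) (measurable_const (a := (0 : ℝ))) hGm
      (K := 0) (by simp) hGb (Z := fun _ => 1) measurable_const (by simp)
    have hnn : ∀ ω, 0 ≤ ∫ r in (2 : ℝ)..3, -(if X r ω = 0 then (-3 : ℝ) else 0) := fun ω =>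
      intervalIntegral.integral_nonneg (by norm_num) fun r _ => by split_ifs <;> norm_num
    have heq : ∀ ω, 1 * pathFunctional X 2 3 (fun _ => 0) (fun x => if x = 0 then (-3 : ℝ) else 0) ω
        = ∫ r in (2 : ℝ)..3, -(if X r ω = 0 then (-3 : ℝ) else 0) := fun ω => by
      simp only [pathFunctional, intervalIntegral.integral_neg]
      ring
    simp only [heq] at h0 hint
    filter_upwards [(integral_eq_zero_iff_of_nonneg hnn hint).1 h0] with ω hω
    have h1 := (intervalIntegral.integral_eq_zero_iff_of_le_of_nonneg_ae
      (show (2 : ℝ) ≤ 3 by norm_num)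
      (ae_of_all _ fun r => by simp only [Pi.zero_apply, Pi.neg_apply]; split_ifs <;> norm_num)
      (intervalIntegrable_comp hXc hGm hGb ω).neg).1 hω
    rw [Filter.EventuallyEq, ae_restrict_iff' measurableSet_Ioc] at h1
    filter_upwards [h1] with r hr hr' h2
    simpa [h2] using hr hr'
  · generalize X r ω = x
    by_cases hx : x = 0
    · simp [generatorSq, hx]
    · simp only [generatorSq, if_neg hx]
      refine tendsto_const_nhds.congr' ?_
      have hx2 : 0 < x ^ 2 := by positivity
      filter_upwards [hc0.eventually_lt_const hx2] with n hn
      rw [max_eq_right (sub_nonpos.2 ((one_le_div (hc n)).2 hn.le))]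
      simp

/-- The process `(1 - |X|)₊ ^ 3` grows in mean at least three times as fast as its own mean. -/
theorem IsWeakSolutionOn.integral_mul_pathFunctional_nonneg
    (hS : IsWeakSolutionOn F P bCE X B x₀ 3) {t : ℝ} (ht : t ∈ Icc (2 : ℝ) 3) {Z : Ω → ℝ}
    (hZ : Measurable[F 2] Z) (hZ1 : ∀ ω, |Z ω| ≤ 1) (hZ0 : ∀ ω, 0 ≤ Z ω) :
    0 ≤ ∫ ω, Z ω * pathFunctional X 2 t (fun x => max (1 - |x|) 0 ^ 3)
      (fun x => 3 * max (1 - |x|) 0 ^ 3) ω ∂P := by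
  have hne := hS.ae_ne_zero
  have hzero := fun c hc =>
    hS.integral_mul_pathFunctional_eq_zero (isProfile_sqrt (c := c) hc) ht hZ hZ1
  obtain ⟨hF, -, -, hXc, hX, -, -⟩ := hS
  have hXm : ∀ t, 0 ≤ t → Measurable (X t) := fun t ht => (hX t ht).mono (hF t ht) le_rfl
  have hZm : Measurable Z := hZ.mono (hF 2 zero_le_two) le_rfl
  obtain ⟨c, hc0, hpos⟩ : ∃ c : ℕ → ℝ, Filter.Tendsto c Filter.atTop (nhds 0) ∧ ∀ n, 0 < c n :=
    ⟨fun n => 1 / ((n : ℝ) + 1), tendsto_one_div_add_atTop_nhds_zero_nat,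
      fun n => Nat.one_div_pos_of_nat⟩
  have hHb : ∀ n x, |max (1 - √(x ^ 2 + c n)) 0 ^ 3| ≤ 1 := fun n x => by
    rw [abs_of_nonneg (by positivity)]
    exact pow_le_one₀ (le_max_right _ _)
      (max_le (sub_le_self _ (Real.sqrt_nonneg _)) zero_le_one)
  have hGb : ∀ n x, |3 * (x ^ 2 / (x ^ 2 + c n)) * max (1 - √(x ^ 2 + c n)) 0 ^ 3| ≤ 3 := by
    intro n x
    have h1 : x ^ 2 / (x ^ 2 + c n) ≤ 1 :=
      div_le_one_of_le₀ (by linarith [hpos n]) (by linarith [hpos n, sq_nonneg x])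
    have h2 : 0 ≤ x ^ 2 / (x ^ 2 + c n) :=
      div_nonneg (sq_nonneg x) (by linarith [hpos n, sq_nonneg x])
    rw [abs_mul, abs_of_nonneg (by positivity)]
    nlinarith [hHb n x, abs_nonneg (max (1 - √(x ^ 2 + c n)) 0 ^ 3)]
  have hsqrt : ∀ x : ℝ, Filter.Tendsto (fun n => max (1 - √(x ^ 2 + c n)) 0 ^ 3) Filter.atTop
      (nhds (max (1 - |x|) 0 ^ 3)) := fun x => by
    have : Continuous fun z => max (1 - √(x ^ 2 + z)) 0 ^ 3 := by fun_prop
    simpa only [Function.comp_def, add_zero, Real.sqrt_sq_eq_abs] using (this.tendsto 0).comp hc0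
  have hGm : ∀ n, Measurable fun x : ℝ =>
      3 * (x ^ 2 / (x ^ 2 + c n)) * max (1 - √(x ^ 2 + c n)) 0 ^ 3 := fun n => by fun_prop
  refine ge_of_tendsto (tendsto_integral_mul_pathFunctional (P := P) hXm hXc zero_le_two ht.1
    (H := fun n x => max (1 - √(x ^ 2 + c n)) 0 ^ 3)
    (G := fun n x => 3 * (x ^ 2 / (x ^ 2 + c n)) * max (1 - √(x ^ 2 + c n)) 0 ^ 3)
    (fun n => by fun_prop) hGm hHb hGb hsqrt ?_ hZm hZ1)
    (Filter.Eventually.of_forall fun n => ?_)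
  · filter_upwards [hne] with ω hω
    filter_upwards [hω] with r hr hr'
    have hx := hr ⟨hr'.1, hr'.2.trans ht.2⟩
    have hx2 : X r ω ^ 2 ≠ 0 := pow_ne_zero 2 hx
    have h1 := (tendsto_const_nhds (x := X r ω ^ 2)).div
      ((tendsto_const_nhds (x := X r ω ^ 2)).add hc0) (by rwa [add_zero])
    rw [add_zero, div_self hx2] at h1
    simpa only [mul_one, Pi.div_apply] using (h1.const_mul 3).mul (hsqrt (X r ω))
  · have hp := isProfile_sqrt (hpos n)
    obtain ⟨K, hK⟩ := hp.exists_abs_generatorSq_le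
    refine (hzero _ (hpos n)).symm.le.trans (integral_mono_ae
      (integrable_mul_pathFunctional hXm hXc zero_le_two ht.1 (by fun_prop)
        hp.measurable_generatorSq (hHb n) hK hZm hZ1)
      (integrable_mul_pathFunctional hXm hXc zero_le_two ht.1 (by fun_prop) (hGm n) (hHb n)
        (hGb n) hZm hZ1) ?_)
    filter_upwards [hne] with ω hω
    refine mul_le_mul_of_nonneg_left (sub_le_sub_left ?_ _) (hZ0 ω)
    rw [intervalIntegral.integral_of_le ht.1, intervalIntegral.integral_of_le ht.1]
    refine setIntegral_mono_ae_restrict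
      (intervalIntegrable_comp hXc (hGm n) (hGb n) ω).1
      (intervalIntegrable_comp hXc hp.measurable_generatorSq hK ω).1 ?_
    rw [Filter.EventuallyLE, ae_restrict_iff' measurableSet_Ioc]
    filter_upwards [hω] with r hr hr'
    exact le_generatorSq_sqrt (hpos n) (hr ⟨hr'.1, hr'.2.trans ht.2⟩)

/-- A weak solution does not visit a neighbourhood of the origin at time `2`. -/
theorem IsWeakSolutionOn.measure_abs_lt_eq_zero (hS : IsWeakSolutionOn F P bCE X B x₀ 3) :
    P {ω | |X 2 ω| < 1 / 4} = 0 := by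
  have hIto := fun {t} (ht : t ∈ Icc (2 : ℝ) 3) {Z} =>
    hS.integral_mul_pathFunctional_nonneg ht (Z := Z)
  obtain ⟨hF, -, -, hXc, hX, -, -⟩ := hS
  have hXm : ∀ t, 0 ≤ t → Measurable (X t) := fun t ht => (hX t ht).mono (hF t ht) le_rfl
  have hA : MeasurableSet[F 2] {ω | |X 2 ω| < 1 / 4} :=
    hX 2 zero_le_two (measurableSet_lt measurable_id.abs measurable_const)
  set A := {ω | |X 2 ω| < 1 / 4}
  have hAm : MeasurableSet A := hF 2 zero_le_two _ hA
  set Z : Ω → ℝ := A.indicator fun _ => 1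
  have hZ : Measurable[F 2] Z := measurable_const.indicator hA
  have hZm : Measurable Z := hZ.mono (hF 2 zero_le_two) le_rfl
  have hZ0 : ∀ ω, 0 ≤ Z ω := fun ω => indicator_nonneg (fun _ _ => zero_le_one) ω
  have hZle : ∀ ω, Z ω ≤ 1 := fun ω => indicator_le_self' (fun _ _ => zero_le_one) ω
  have hZ1 : ∀ ω, |Z ω| ≤ 1 := fun ω => by rw [abs_of_nonneg (hZ0 ω)]; exact hZle ω
  set f : ℝ → ℝ := fun x => max (1 - |x|) 0 ^ 3
  have hfm : Measurable f := by fun_prop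
  have hf0 : ∀ x, 0 ≤ f x := fun x => by positivity
  have hf1 : ∀ x, f x ≤ 1 := fun x =>
    pow_le_one₀ (le_max_right _ _) (max_le (sub_le_self _ (abs_nonneg x)) zero_le_one)
  have hfb : ∀ x, |f x| ≤ 1 := fun x => by rw [abs_of_nonneg (hf0 x)]; exact hf1 x
  have hprod : ∀ ω x, ‖Z ω * f x‖ ≤ 1 := fun ω x => by
    rw [norm_mul]
    exact mul_le_one₀ (hZ1 ω) (abs_nonneg _) (hfb x)
  have hi : ∀ r, 0 ≤ r → Integrable (fun ω => Z ω * f (X r ω)) P := fun r hr =>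
    .of_bound (hZm.mul (hfm.comp (hXm r hr))).aestronglyMeasurable 1 (ae_of_all _ fun ω => hprod _ _)
  set φ : ℝ → ℝ := fun r => ∫ ω, Z ω * f (X r ω) ∂P with hφ
  have hjm : Measurable fun p : Ω × ℝ => Z p.1 * f (X (max p.2 0) p.1) :=
    (hZm.comp measurable_fst).mul (hfm.comp (measurable_uncurry_max_zero hXm hXc))
  have hji : ∀ t, Integrable (fun p : Ω × ℝ => Z p.1 * f (X (max p.2 0) p.1))
      (P.prod (volume.restrict (Ioc 2 t))) := fun t =>
    .of_bound hjm.aestronglyMeasurable 1 (ae_of_all _ fun p => hprod _ _)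
  have growth : ∀ t ∈ Icc (2 : ℝ) 3, φ 2 + 3 * ∫ r in Ioc 2 t, φ r ≤ φ t := by
    intro t ht
    have hFub : ∫ ω, Z ω * (∫ r in (2 : ℝ)..t, f (X r ω)) ∂P = ∫ r in Ioc 2 t, φ r := by
      simp only [intervalIntegral_comp_max_zero f zero_le_two ht.1, ← integral_const_mul]
      rw [integral_integral_swap (hji t)]
      refine setIntegral_congr_fun measurableSet_Ioc fun r hr => ?_
      simp only [hφ, max_eq_left (zero_le_two.trans hr.1.le)]
    have h3 : Integrable (fun ω => Z ω * ∫ r in (2 : ℝ)..t, f (X r ω)) P := by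
      simp only [intervalIntegral_comp_max_zero f zero_le_two ht.1, ← integral_const_mul]
      exact (hji t).integral_prod_left
    have h := hIto ht hZ hZ1 hZ0
    have heq : ∀ ω, Z ω * pathFunctional X 2 t f (fun x => 3 * f x) ω
        = (Z ω * f (X t ω) - Z ω * f (X 2 ω)) - 3 * (Z ω * ∫ r in (2 : ℝ)..t, f (X r ω)) := by
      intro ω
      simp only [pathFunctional, intervalIntegral.integral_const_mul]
      ring
    have ht0 : 0 ≤ t := zero_le_two.trans ht.1
    have hs : Integrable (fun ω => Z ω * f (X t ω) - Z ω * f (X 2 ω)) P :=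
      (hi t ht0).sub (hi 2 zero_le_two)
    rw [integral_congr_ae (ae_of_all _ heq),
      integral_sub hs (h3.const_mul 3),
      integral_sub (hi t ht0) (hi 2 zero_le_two), integral_const_mul, hFub] at h
    linarith
  have hφ0 : ∀ r, 0 ≤ φ r := fun r => integral_nonneg fun ω => mul_nonneg (hZ0 ω) (hf0 _)
  have hmono : ∀ r ∈ Ioc (2 : ℝ) 3, φ 2 ≤ φ r := fun r hr => by
    have := growth r (Ioc_subset_Icc_self hr)
    have := setIntegral_nonneg (μ := volume) (measurableSet_Ioc (a := (2 : ℝ)) (b := r))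
      fun s _ => hφ0 s
    linarith
  have hφint : IntegrableOn φ (Ioc 2 3) := by
    refine IntegrableOn.congr_fun (hji 3).integral_prod_right (fun r hr => ?_) measurableSet_Ioc
    simp only [hφ, max_eq_left (zero_le_two.trans hr.1.le)]
  have hfour : 4 * φ 2 ≤ φ 3 := by
    have h1 := growth 3 (by norm_num)
    have h2 := setIntegral_mono_on (integrableOn_const (C := φ 2) (by simp)) hφint
      measurableSet_Ioc hmono
    norm_num at h2
    linarith
  have hZint : ∫ ω, Z ω ∂P = P.real A := integral_indicator_one hAm
  have hup : φ 3 ≤ P.real A := by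
    rw [← hZint]
    exact integral_mono (hi 3 (by norm_num)) ((integrable_const 1).indicator hAm) fun ω =>
      mul_le_of_le_one_right (hZ0 ω) (hf1 _)
  have hlow : 27 / 64 * P.real A ≤ φ 2 := by
    rw [← hZint, ← integral_const_mul]
    refine integral_mono (((integrable_const 1).indicator hAm).const_mul _) (hi 2 zero_le_two)
      fun ω => ?_
    by_cases hω : ω ∈ A
    · have h1 : 3 / 4 ≤ max (1 - |X 2 ω|) 0 :=
        le_max_of_le_left (by have : |X 2 ω| < 1 / 4 := hω; linarith)
      have h2 := pow_le_pow_left₀ (by norm_num) h1 3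
      simp only [Z, indicator_of_mem hω, f]
      linarith
    · simp [Z, indicator_of_notMem hω]
  have hA0 : P.real A = 0 := le_antisymm (by linarith) measureReal_nonneg
  exact (measureReal_eq_zero_iff).1 hA0

/-- Undisturbed by the drift on `[1, 2)`, a weak solution reaches every neighbourhood of the origin
at time `2` with positive probability. -/
theorem IsWeakSolutionOn.measure_abs_lt_ne_zero (hS : IsWeakSolutionOn F P bCE X B x₀ 3) :
    P {ω | |X 2 ω| < 1 / 4} ≠ 0 := by
  have hsde := hS.ae_eq_add_integral zero_le_one one_le_two (by norm_num)
  obtain ⟨hF, -, ⟨-, -, hBm, hind, hlaw⟩, hXc, hX, -, -⟩ := hS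
  have hD : Measurable fun ω => B 2 ω - B 1 ω :=
    ((hBm 2 zero_le_two).mono (hF 2 zero_le_two) le_rfl).sub
      ((hBm 1 zero_le_one).mono (hF 1 zero_le_one) le_rfl)
  obtain ⟨q, hq⟩ : ∃ q : ℚ, P {ω | |X 1 ω - q| < 1 / 8} ≠ 0 := by
    by_contra! h
    have huniv : ⋃ q : ℚ, {ω | |X 1 ω - q| < 1 / 8} = univ := eq_univ_of_forall fun ω => by
      obtain ⟨q, h1, h2⟩ := exists_rat_btwn (show X 1 ω - 1 / 8 < X 1 ω by linarith)
      exact mem_iUnion.2 ⟨q, show |X 1 ω - q| < 1 / 8 from abs_lt.2 ⟨by linarith, by linarith⟩⟩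
    have := measure_iUnion_null h
    rw [huniv, measure_univ] at this
    exact one_ne_zero this
  have hU : IsOpen {y : ℝ | |y + q| < 1 / 8} := isOpen_lt (by fun_prop) continuous_const
  have hN : P {ω | |B 2 ω - B 1 ω + q| < 1 / 8} ≠ 0 := by
    have h1 := hlaw 1 2 zero_le_one one_le_two
    have h2 : P {ω | |B 2 ω - B 1 ω + q| < 1 / 8}
        = gaussianReal 0 (Real.toNNReal (2 - 1)) {y : ℝ | |y + q| < 1 / 8} := by
      rw [← h1, Measure.map_apply hD hU.measurableSet]
      rfl
    rw [h2]
    intro h0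
    exact (hU.measure_pos volume ⟨-q, by norm_num⟩).ne'
      (gaussianReal_absolutelyContinuous' 0 (by norm_num) h0)
  have hprod := (Indep_iff _ _ _).1 (hind 1 2 zero_le_one one_le_two)
    {ω | |B 2 ω - B 1 ω + q| < 1 / 8} {ω | |X 1 ω - q| < 1 / 8}
    ⟨_, hU.measurableSet, rfl⟩
    (hX 1 zero_le_one (measurableSet_lt (measurable_id.sub_const (q : ℝ)).abs measurable_const))
  intro h0
  refine mul_ne_zero hN hq (hprod.symm.trans (measure_mono_null_ae ?_ h0))
  filter_upwards [hsde] with ω hω hω'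
  have hd : ∫ s in (1 : ℝ)..2, bCE s (X s ω) = 0 := by
    rw [intervalIntegral.integral_of_le one_le_two, integral_Ioc_eq_integral_Ioo]
    refine setIntegral_eq_zero_of_forall_eq_zero fun s hs => ?_
    simp [bCE, hs.1.not_gt, hs.2]
  have h2 := hω.2 2 ⟨one_le_two, le_rfl⟩
  rw [hd] at h2
  have h3 : |B 2 ω - B 1 ω + q| < 1 / 8 := hω'.1
  have h4 : |X 1 ω - q| < 1 / 8 := hω'.2
  rw [abs_lt] at h3 h4
  exact show |X 2 ω| < 1 / 4 from abs_lt.2 ⟨by linarith, by linarith⟩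

end BCE

/-- There exists no weak solution on `[0, 3]` with `X 0 = 0` to
`dX = bCE (t, X) dt + dB`. -/
theorem stmt13 :
    ∀ (Ω : Type) (m : MeasurableSpace Ω) (P : Measure Ω), IsProbabilityMeasure P →
    ∀ (F : ℝ → MeasurableSpace Ω) (X B : ℝ → Ω → ℝ),
      ¬ IsWeakSolutionOn F P bCE X B (fun _ => 0) 3 := by
  intro Ω _ P _ F X B hS
  exact hS.measure_abs_lt_ne_zero hS.measure_abs_lt_eq_zero
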